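/- arXiv:2012.00911 — 10 statements merged into one kernel-verified Lean document; each statement's English description precedes it below -/
import Mathlib

section
/- Suppose E[X] = 0, P(X = 0) < 1 and λ* > 0 (so Λ is finite and differentiable on (0, λ*)), and suppose Λ'(λ) → +∞ as λ ↑ λ*. Then for every x > 0 there exists λ ∈ (0, λ*) such that Λ'(λ) = x and I(x) = λ·Λ'(λ) − Λ(λ). -/
open MeasureTheory Filter Set Topology

open scoped Classical in
/-- Cumulant generating function valued in `EReal` (equal to `+∞` where the
moment generating function is infinite). -/
noncomputable def cgfE {Ω : Type*} [MeasurableSpace Ω] (μ : Measure Ω) (X : Ω → ℝ) (t : ℝ) :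
    EReal :=
  if Integrable (fun ω => Real.exp (t * X ω)) μ then
    ((Real.log (∫ ω, Real.exp (t * X ω) ∂μ) : ℝ) : EReal)
  else ⊤

/-- Real-valued version of the cumulant generating function (meaningful where the
moment generating function is finite). -/
noncomputable def cgfR {Ω : Type*} [MeasurableSpace Ω] (μ : Measure Ω) (X : Ω → ℝ) (t : ℝ) :
    ℝ :=
  Real.log (∫ ω, Real.exp (t * X ω) ∂μ)

/-- The Cramér (Legendre) rate function `I(x) = sup_t (t x - Λ(t))`, valued in `[0,∞]`. -/
noncomputable def rateI {Ω : Type*} [MeasurableSpace Ω] (μ : Measure Ω) (X : Ω → ℝ) (x : ℝ) :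
    EReal :=
  ⨆ t : ℝ, (((t * x : ℝ) : EReal) - cgfE μ X t)

/-- `λ* = sup {λ ≥ 0 : E[exp(λ X)] < ∞}`, valued in `EReal`. -/
noncomputable def lamStar {Ω : Type*} [MeasurableSpace Ω] (μ : Measure Ω) (X : Ω → ℝ) :
    EReal :=
  sSup {l : EReal | ∃ lr : ℝ, l = (lr : EReal) ∧ 0 ≤ lr ∧
    Integrable (fun ω => Real.exp (lr * X ω)) μ}

/-- Positive reals below `λ*` are interior points of the finiteness domain of the mgf. -/
theorem mem_interior_integrableExpSet_of_lt_lamStar {Ω : Type*} [MeasurableSpace Ω]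
    {μ : Measure Ω} [IsProbabilityMeasure μ] {X : Ω → ℝ} {l : ℝ} (hl : 0 < l)
    (hlt : (l : EReal) < lamStar μ X) :
    l ∈ interior (ProbabilityTheory.integrableExpSet X μ) := by
  obtain ⟨_, ⟨b, rfl, -, hb⟩, hlb⟩ := lt_sSup_iff.mp hlt
  rw [EReal.coe_lt_coe_iff] at hlb
  have h0 : (0 : ℝ) ∈ ProbabilityTheory.integrableExpSet X μ := by
    simp [ProbabilityTheory.integrableExpSet]
  have hsub : Icc 0 b ⊆ ProbabilityTheory.integrableExpSet X μ :=
    ProbabilityTheory.convex_integrableExpSet.ordConnected.out h0 hb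
  exact interior_mono hsub (by rw [interior_Icc]; exact ⟨hl, hlb⟩)

/-- The tangent line inequality for the cumulant generating function at an interior point. -/
theorem cgfR_add_le {Ω : Type*} [MeasurableSpace Ω] {μ : Measure Ω} [IsProbabilityMeasure μ]
    {X : Ω → ℝ} {l t : ℝ} (hl : l ∈ interior (ProbabilityTheory.integrableExpSet X μ))
    (ht : Integrable (fun ω => Real.exp (t * X ω)) μ) :
    cgfR μ X l + (t - l) * deriv (cgfR μ X) l ≤ cgfR μ X t := by
  have hil : Integrable (fun ω => Real.exp (l * X ω)) μ :=
    ProbabilityTheory.integrable_of_mem_integrableExpSet (interior_subset hl)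
  have hiX : Integrable (fun ω => X ω * Real.exp (l * X ω)) μ := by
    simpa using ProbabilityTheory.integrable_pow_mul_exp_of_mem_interior_integrableExpSet hl 1
  have hpos : 0 < ∫ ω, Real.exp (l * X ω) ∂μ := integral_exp_pos hil
  have hD : deriv (cgfR μ X) l
      = (∫ ω, X ω * Real.exp (l * X ω) ∂μ) / ∫ ω, Real.exp (l * X ω) ∂μ :=
    ProbabilityTheory.deriv_cgf hl
  set D := deriv (cgfR μ X) l
  have hDM : ∫ ω, X ω * Real.exp (l * X ω) ∂μ = D * ∫ ω, Real.exp (l * X ω) ∂μ := by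
    rw [hD, div_mul_cancel₀ _ hpos.ne']
  set c := (t - l) * D with hc
  have hle : ∫ ω, (Real.exp c * (1 - c) * Real.exp (l * X ω)
        + Real.exp c * (t - l) * (X ω * Real.exp (l * X ω))) ∂μ
      ≤ ∫ ω, Real.exp (t * X ω) ∂μ := by
    refine integral_mono ((hil.const_mul _).add (hiX.const_mul _)) ht fun ω => ?_
    have h1 := Real.add_one_le_exp ((t - l) * X ω - c)
    have h2 : Real.exp (t * X ω)
        = Real.exp c * Real.exp (l * X ω) * Real.exp ((t - l) * X ω - c) := by
      rw [← Real.exp_add, ← Real.exp_add]; congr 1; ring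
    have h3 : 0 ≤ Real.exp c * Real.exp (l * X ω) := by positivity
    have h4 := mul_le_mul_of_nonneg_left h1 h3
    simp only
    rw [h2]
    linarith
  rw [integral_add (hil.const_mul _) (hiX.const_mul _), integral_const_mul, integral_const_mul,
    hDM] at hle
  have hle' : Real.exp c * ∫ ω, Real.exp (l * X ω) ∂μ ≤ ∫ ω, Real.exp (t * X ω) ∂μ := by
    refine le_trans (le_of_eq ?_) hle
    rw [hc]; ring
  have hlog := Real.log_le_log (by positivity) hle'
  rw [Real.log_mul (Real.exp_pos c).ne' hpos.ne', Real.log_exp] at hlog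
  unfold cgfR
  linarith

/-- At an interior point, the Legendre transform at `Λ'(l)` is attained at `l`. -/
theorem rateI_deriv_cgfR {Ω : Type*} [MeasurableSpace Ω] {μ : Measure Ω}
    [IsProbabilityMeasure μ] {X : Ω → ℝ} {l : ℝ}
    (hl : l ∈ interior (ProbabilityTheory.integrableExpSet X μ)) :
    rateI μ X (deriv (cgfR μ X) l)
      = ((l * deriv (cgfR μ X) l - cgfR μ X l : ℝ) : EReal) := by
  have hcgfE : ∀ t, Integrable (fun ω => Real.exp (t * X ω)) μ →
      cgfE μ X t = (cgfR μ X t : EReal) := fun t ht => by rw [cgfE, if_pos ht, cgfR]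
  refine le_antisymm (iSup_le fun t => ?_) ?_
  · by_cases ht : Integrable (fun ω => Real.exp (t * X ω)) μ
    · rw [hcgfE t ht, ← EReal.coe_sub, EReal.coe_le_coe_iff]
      linarith [cgfR_add_le hl ht]
    · rw [cgfE, if_neg ht]
      simp
  · refine le_iSup_of_le l ?_
    rw [hcgfE l (ProbabilityTheory.integrable_of_mem_integrableExpSet (interior_subset hl)),
      ← EReal.coe_sub]

/-- The derivative of the cumulant generating function tends to the mean at `0` from the right. -/
theorem tendsto_deriv_cgfR_nhdsGT_zero {Ω : Type*} [MeasurableSpace Ω] {μ : Measure Ω}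
    [IsProbabilityMeasure μ] {X : Ω → ℝ} (hint : Integrable X μ) (hlam : 0 < lamStar μ X) :
    Tendsto (deriv (cgfR μ X)) (𝓝[>] 0) (𝓝 (∫ ω, X ω ∂μ)) := by
  obtain ⟨b, hb0, hb⟩ := EReal.lt_iff_exists_real_btwn.mp hlam
  have hb0 : 0 < b := by exact_mod_cast hb0
  have hbi := mem_interior_integrableExpSet_of_lt_lamStar hb0 hb
  have hev : ∀ᶠ l in 𝓝[>] (0 : ℝ), l ∈ Ioo 0 b := Ioo_mem_nhdsGT hb0
  have hXm := hint.aestronglyMeasurable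
  have hem : ∀ l : ℝ, AEStronglyMeasurable (fun ω => Real.exp (l * X ω)) μ := fun l =>
    Real.continuous_exp.comp_aestronglyMeasurable (hXm.const_mul l)
  have hbound : ∀ l ∈ Ioo 0 b, ∀ ω, Real.exp (l * X ω) ≤ 1 + Real.exp (b * X ω) := by
    intro l hl ω
    rcases le_total (X ω) 0 with h | h
    · have : Real.exp (l * X ω) ≤ 1 :=
        Real.exp_le_one_iff.mpr (mul_nonpos_of_nonneg_of_nonpos hl.1.le h)
      linarith [Real.exp_pos (b * X ω)]
    · have : Real.exp (l * X ω) ≤ Real.exp (b * X ω) :=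
        Real.exp_le_exp.mpr (mul_le_mul_of_nonneg_right hl.2.le h)
      linarith
  have hexp : ∀ ω, Tendsto (fun l : ℝ => Real.exp (l * X ω)) (𝓝[>] 0) (𝓝 1) := by
    intro ω
    have : Continuous fun l : ℝ => Real.exp (l * X ω) := by fun_prop
    simpa using (this.tendsto 0).mono_left nhdsWithin_le_nhds
  have hnum : Tendsto (fun l : ℝ => ∫ ω, X ω * Real.exp (l * X ω) ∂μ) (𝓝[>] 0)
      (𝓝 (∫ ω, X ω ∂μ)) := by
    refine tendsto_integral_filter_of_dominated_convergence
      (fun ω => |X ω| + |X ω| * Real.exp (b * X ω))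
      (Eventually.of_forall fun l => hXm.mul (hem l)) ?_ ?_ ?_
    · filter_upwards [hev] with l hl
      refine Eventually.of_forall fun ω => ?_
      rw [norm_mul, Real.norm_eq_abs, Real.norm_eq_abs, Real.abs_exp]
      have := mul_le_mul_of_nonneg_left (hbound l hl ω) (abs_nonneg (X ω))
      linarith
    · refine hint.abs.add ?_
      simpa using
        ProbabilityTheory.integrable_pow_abs_mul_exp_of_mem_interior_integrableExpSet hbi 1
    · refine Eventually.of_forall fun ω => ?_
      simpa using (hexp ω).const_mul (X ω)
  have hden : Tendsto (fun l : ℝ => ∫ ω, Real.exp (l * X ω) ∂μ) (𝓝[>] 0) (𝓝 1) := by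
    have : Tendsto (fun l : ℝ => ∫ ω, Real.exp (l * X ω) ∂μ) (𝓝[>] 0)
        (𝓝 (∫ _, (1 : ℝ) ∂μ)) := by
      refine tendsto_integral_filter_of_dominated_convergence
        (fun ω => 1 + Real.exp (b * X ω)) (Eventually.of_forall hem) ?_ ?_
        (Eventually.of_forall hexp)
      · filter_upwards [hev] with l hl
        refine Eventually.of_forall fun ω => ?_
        rw [Real.norm_eq_abs, Real.abs_exp]
        exact hbound l hl ω
      · exact (integrable_const 1).add
          (ProbabilityTheory.integrable_of_mem_integrableExpSet (interior_subset hbi))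
    simpa using this
  have hdiv := hnum.div hden one_ne_zero
  rw [div_one] at hdiv
  refine hdiv.congr' ?_
  filter_upwards [hev] with l hl
  refine (ProbabilityTheory.deriv_cgf (mem_interior_integrableExpSet_of_lt_lamStar hl.1 ?_)).symm
  exact (EReal.coe_lt_coe_iff.mpr hl.2).trans hb

theorem stmt0 {Ω : Type*} [MeasurableSpace Ω] (μ : Measure Ω) [IsProbabilityMeasure μ]
    (X : Ω → ℝ) (hmeas : Measurable X) (hint : Integrable X μ)
    (hmean : ∫ ω, X ω ∂μ = 0) (hX0 : μ {ω | X ω = 0} < 1)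
    (hlam : 0 < lamStar μ X)
    (hderiv : Tendsto (fun l : ℝ => deriv (cgfR μ X) l)
      (Filter.comap (fun r : ℝ => (r : EReal)) (𝓝[<] lamStar μ X)) atTop) :
    ∀ x : ℝ, 0 < x → ∃ l : ℝ, 0 < l ∧ (l : EReal) < lamStar μ X ∧
      deriv (cgfR μ X) l = x ∧
      rateI μ X x = ((l * deriv (cgfR μ X) l - cgfR μ X l : ℝ) : EReal) := by
  intro x hx
  obtain ⟨u, ⟨hu0, hu⟩, hux⟩ : ∃ u : ℝ, (0 < u ∧ (u : EReal) < lamStar μ X) ∧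
      x ≤ deriv (cgfR μ X) u := by
    obtain ⟨s, hs, hsub⟩ := Filter.mem_comap.mp (hderiv.eventually_ge_atTop x)
    obtain ⟨a, ha, has⟩ := (mem_nhdsLT_iff_exists_Ioo_subset' hlam).mp hs
    obtain ⟨u, hau, hu⟩ := EReal.lt_iff_exists_real_btwn.mp (max_lt ha hlam)
    have h := max_lt_iff.mp hau
    exact ⟨u, ⟨by exact_mod_cast h.2, hu⟩, hsub (has ⟨h.1, hu⟩)⟩
  obtain ⟨v, hvx, hv⟩ : ∃ v : ℝ, deriv (cgfR μ X) v < x ∧ v ∈ Ioo 0 u := by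
    have h := tendsto_deriv_cgfR_nhdsGT_zero hint hlam
    rw [hmean] at h
    exact ((h.eventually (gt_mem_nhds hx)).and (Ioo_mem_nhdsGT hu0)).exists
  have hmem : ∀ l ∈ Icc v u, 0 < l ∧ (l : EReal) < lamStar μ X := fun l hl =>
    ⟨hv.1.trans_le hl.1, (EReal.coe_le_coe_iff.mpr hl.2).trans_lt hu⟩
  have hcont : ContinuousOn (deriv (cgfR μ X)) (Icc v u) := fun l hl =>
    (ProbabilityTheory.analyticAt_cgf (mem_interior_integrableExpSet_of_lt_lamStar
      (hmem l hl).1 (hmem l hl).2)).deriv.continuousAt.continuousWithinAt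
  obtain ⟨l, hl, hlx⟩ := intermediate_value_Icc hv.2.le hcont ⟨hvx.le, hux⟩
  obtain ⟨hl0, hls⟩ := hmem l hl
  refine ⟨l, hl0, hls, hlx, ?_⟩
  rw [← rateI_deriv_cgfR (mem_interior_integrableExpSet_of_lt_lamStar hl0 hls), hlx]
end

section
/- Suppose E[X] = 0, P(X = 0) < 1 and λ* > 0 (so Λ is finite and differentiable on (0, λ*)), and suppose Λ'(λ) → +∞ as λ ↑ λ*. Then I(x)/x → λ* as x → +∞ (where, in case λ* = +∞, this means I(x)/x → +∞). -/
open MeasureTheory Filter Set Topology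

/-- The cumulant generating function of a centred random variable is nonnegative. -/
lemma cgfE_nonneg_of_integral_eq_zero {Ω : Type*} [MeasurableSpace Ω] (μ : Measure Ω)
    [IsProbabilityMeasure μ] (X : Ω → ℝ) (hint : Integrable X μ) (hmean : ∫ ω, X ω ∂μ = 0)
    (t : ℝ) : 0 ≤ cgfE μ X t := by
  unfold cgfE
  split_ifs with h
  · have h1 : ∫ ω, (t * X ω + 1) ∂μ ≤ ∫ ω, Real.exp (t * X ω) ∂μ :=
      integral_mono ((hint.const_mul t).add (integrable_const 1)) h
        fun ω => Real.add_one_le_exp (t * X ω)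
    rw [integral_add (hint.const_mul t) (integrable_const 1), integral_const_mul, hmean] at h1
    simp only [mul_zero, zero_add, integral_const, probReal_univ, smul_eq_mul, mul_one] at h1
    exact_mod_cast Real.log_nonneg h1
  · exact le_top

lemma coe_le_lamStar {Ω : Type*} [MeasurableSpace Ω] (μ : Measure Ω) (X : Ω → ℝ) (t : ℝ)
    (ht : 0 ≤ t) (h : Integrable (fun ω => Real.exp (t * X ω)) μ) :
    (t : EReal) ≤ lamStar μ X :=
  le_sSup ⟨t, rfl, ht, h⟩

/-- The rate function of a centred random variable grows at most linearly, with slope `λ*`. -/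
lemma rateI_le_lamStar_mul {Ω : Type*} [MeasurableSpace Ω] (μ : Measure Ω)
    [IsProbabilityMeasure μ] (X : Ω → ℝ) (hint : Integrable X μ) (hmean : ∫ ω, X ω ∂μ = 0)
    (hlam : 0 ≤ lamStar μ X) (x : ℝ) (hx : 0 ≤ x) :
    rateI μ X x ≤ lamStar μ X * (x : EReal) := by
  refine iSup_le fun t => ?_
  by_cases h : Integrable (fun ω => Real.exp (t * X ω)) μ
  · have ht : (t : EReal) ≤ lamStar μ X := by
      rcases le_total 0 t with h0 | h0
      · exact coe_le_lamStar μ X t h0 h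
      · exact le_trans (by exact_mod_cast h0) hlam
    calc ((t * x : ℝ) : EReal) - cgfE μ X t
        ≤ ((t * x : ℝ) : EReal) - 0 :=
          EReal.sub_le_sub le_rfl (cgfE_nonneg_of_integral_eq_zero μ X hint hmean t)
      _ = (t : EReal) * (x : EReal) := by rw [sub_zero, EReal.coe_mul]
      _ ≤ lamStar μ X * (x : EReal) :=
          mul_le_mul_of_nonneg_right ht (by exact_mod_cast hx)
  · simp [cgfE, h]

lemma coe_mul_sub_cgfR_le_rateI {Ω : Type*} [MeasurableSpace Ω] (μ : Measure Ω) (X : Ω → ℝ)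
    (t x : ℝ) (h : Integrable (fun ω => Real.exp (t * X ω)) μ) :
    ((t * x - cgfR μ X t : ℝ) : EReal) ≤ rateI μ X x := by
  refine le_trans (le_of_eq ?_) (le_iSup (fun t : ℝ => ((t * x : ℝ) : EReal) - cgfE μ X t) t)
  simp only [cgfE, h, if_true, cgfR, EReal.coe_sub]

theorem stmt1 {Ω : Type*} [MeasurableSpace Ω] (μ : Measure Ω) [IsProbabilityMeasure μ]
    (X : Ω → ℝ) (hmeas : Measurable X) (hint : Integrable X μ)
    (hmean : ∫ ω, X ω ∂μ = 0) (hX0 : μ {ω | X ω = 0} < 1)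
    (hlam : 0 < lamStar μ X)
    (hderiv : Tendsto (fun l : ℝ => deriv (cgfR μ X) l)
      (Filter.comap (fun r : ℝ => (r : EReal)) (𝓝[<] lamStar μ X)) atTop) :
    Tendsto (fun x : ℝ => rateI μ X x / ((x : ℝ) : EReal)) atTop (𝓝 (lamStar μ X)) := by
  rw [tendsto_order]
  refine ⟨fun c hc => ?_, fun c hc => ?_⟩
  · obtain ⟨_, ⟨t, rfl, -, ht⟩, hct⟩ := lt_sSup_iff.mp hc
    have hlim : Tendsto (fun x : ℝ => t - cgfR μ X t / x) atTop (𝓝 t) := by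
      simpa using (tendsto_const_nhds (x := t)).sub
        ((tendsto_const_nhds (x := cgfR μ X t)).div_atTop tendsto_id)
    have hlimE := (continuous_coe_real_ereal.tendsto t).comp hlim
    filter_upwards [hlimE.eventually (lt_mem_nhds hct), eventually_gt_atTop 0] with x hx hx0
    refine hx.trans_le ?_
    have heq : t - cgfR μ X t / x = (t * x - cgfR μ X t) / x := by
      field_simp
    rw [Function.comp_apply, heq, EReal.coe_div]
    exact EReal.div_le_div_right_of_nonneg (by exact_mod_cast hx0.le)
      (coe_mul_sub_cgfR_le_rateI μ X t x ht)
  · filter_upwards [eventually_gt_atTop 0] with x hx0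
    refine lt_of_le_of_lt ?_ hc
    rw [EReal.div_le_iff_le_mul (by exact_mod_cast hx0) (EReal.coe_ne_top x), mul_comm]
    exact rateI_le_lamStar_mul μ X hint hmean hlam.le x hx0.le
end

section
/- Suppose E[X] = 0, P(X = 0) < 1, λ* = +∞, and Λ'(λ) converges to a finite limit as λ → +∞. Then the essential supremum of X is finite and Λ'(λ) increases to ess sup X as λ → +∞. -/
open MeasureTheory Filter Set Topology

open ProbabilityTheory in
/-- If `λ* = +∞`, then every positive parameter lies in the interior of the set where the moment
generating function is finite. -/
lemma mem_interior_integrableExpSet_of_lamStar_eq_top {Ω : Type*} [MeasurableSpace Ω]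
    {μ : Measure Ω} [IsFiniteMeasure μ] {X : Ω → ℝ} (hlam : lamStar μ X = ⊤) {t : ℝ}
    (ht : 0 < t) : t ∈ interior (integrableExpSet X μ) := by
  refine mem_interior.2 ⟨Ioi 0, fun s (hs : 0 < s) ↦ ?_, isOpen_Ioi, ht⟩
  have hlt : (s : EReal) < lamStar μ X := hlam ▸ EReal.coe_lt_top s
  obtain ⟨_, ⟨r, rfl, -, hr⟩, hsr⟩ := lt_sSup_iff.1 hlt
  exact integrable_exp_mul_of_nonneg_of_le hr hs.le (EReal.coe_lt_coe_iff.1 hsr).le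

open ProbabilityTheory in
/-- The derivative of the cumulant generating function is monotone on every convex subset of the
interior of the set where the moment generating function is finite. -/
lemma monotoneOn_deriv_cgf {Ω : Type*} [MeasurableSpace Ω] {μ : Measure Ω} {X : Ω → ℝ}
    {s : Set ℝ} (hs : Convex ℝ s) (h : s ⊆ interior (integrableExpSet X μ)) :
    MonotoneOn (deriv (cgf X μ)) s := by
  have han : ∀ t ∈ s, AnalyticAt ℝ (deriv (cgf X μ)) t := fun t ht ↦ (analyticAt_cgf (h ht)).deriv
  refine monotoneOn_of_deriv_nonneg hs (fun t ht ↦ (han t ht).continuousAt.continuousWithinAt)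
    (fun t ht ↦ (han t (interior_subset ht)).differentiableAt.differentiableWithinAt)
    fun t ht ↦ ?_
  have h2 := variance_tilted_mul (h (interior_subset ht))
  rw [iteratedDeriv_succ, iteratedDeriv_one] at h2
  exact h2 ▸ variance_nonneg _ _

open ProbabilityTheory in
/-- An almost sure upper bound of `X` bounds the derivative of its cumulant generating function. -/
lemma deriv_cgf_le_of_ae_le {Ω : Type*} [MeasurableSpace Ω] {μ : Measure Ω} [NeZero μ]
    {X : Ω → ℝ} {t c : ℝ} (ht : t ∈ interior (integrableExpSet X μ)) (hc : ∀ᵐ ω ∂μ, X ω ≤ c) :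
    deriv (cgf X μ) t ≤ c := by
  have hint : Integrable (fun ω ↦ Real.exp (t * X ω)) μ :=
    interior_subset (s := integrableExpSet X μ) ht
  rw [deriv_cgf ht, div_le_iff₀ (mgf_pos' (NeZero.ne μ) hint), mgf, ← integral_const_mul]
  refine integral_mono_ae ?_ (hint.const_mul c) ?_
  · simpa using integrable_pow_mul_exp_of_mem_interior_integrableExpSet ht 1
  · filter_upwards [hc] with ω hω
    exact mul_le_mul_of_nonneg_right hω (Real.exp_pos _).le

open ProbabilityTheory in
/-- If the cumulant generating function grows at most linearly with slope `T` at `+∞`, then `X` is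
almost surely at most `T`. -/
lemma ae_le_of_cgf_le {Ω : Type*} [MeasurableSpace Ω] {μ : Measure Ω} [IsFiniteMeasure μ]
    {X : Ω → ℝ} {T b : ℝ}
    (h : ∀ᶠ t in atTop, Integrable (fun ω ↦ Real.exp (t * X ω)) μ ∧ cgf X μ t ≤ T * t + b) :
    ∀ᵐ ω ∂μ, X ω ≤ T := by
  have key : ∀ c, T < c → ∀ᵐ ω ∂μ, X ω < c := by
    intro c hc
    have hlim : Tendsto (fun t : ℝ ↦ Real.exp ((T - c) * t + b)) atTop (𝓝 0) :=
      Real.tendsto_exp_atBot.comp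
        (tendsto_atBot_add_const_right _ b (tendsto_id.const_mul_atTop_of_neg (sub_neg.2 hc)))
    have hle : μ.real {ω | c ≤ X ω} ≤ 0 := by
      refine ge_of_tendsto hlim ?_
      filter_upwards [h, eventually_ge_atTop 0] with t ht ht0
      exact (measure_ge_le_exp_cgf c ht0 ht.1).trans
        (Real.exp_le_exp.2 (by linarith [ht.2]))
    have hzero : μ {ω | c ≤ X ω} = 0 :=
      (measureReal_eq_zero_iff).1 (le_antisymm hle measureReal_nonneg)
    simpa [ae_iff] using hzero
  have hn : ∀ n : ℕ, ∀ᵐ ω ∂μ, X ω < T + 1 / ((n : ℝ) + 1) := fun n ↦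
    key _ (lt_add_of_pos_right _ Nat.one_div_pos_of_nat)
  filter_upwards [ae_all_iff.2 hn] with ω hω
  refine le_of_forall_pos_lt_add fun ε hε ↦ ?_
  obtain ⟨n, hn⟩ := exists_nat_one_div_lt hε
  exact (hω n).trans (by linarith)

theorem stmt2 {Ω : Type*} [MeasurableSpace Ω] (μ : Measure Ω) [IsProbabilityMeasure μ]
    (X : Ω → ℝ) (hmeas : Measurable X) (hint : Integrable X μ)
    (hmean : ∫ ω, X ω ∂μ = 0) (hX0 : μ {ω | X ω = 0} < 1)
    (hlam : lamStar μ X = ⊤)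
    (hconv : ∃ T : ℝ, Tendsto (fun l : ℝ => deriv (cgfR μ X) l) atTop (𝓝 T)) :
    ∃ M : ℝ, essSup (fun ω => ((X ω : EReal))) μ = (M : EReal) ∧
      MonotoneOn (fun l : ℝ => deriv (cgfR μ X) l) (Set.Ioi 0) ∧
      Tendsto (fun l : ℝ => deriv (cgfR μ X) l) atTop (𝓝 M) := by
  obtain ⟨T, hT⟩ := hconv
  change Tendsto (fun l ↦ deriv (ProbabilityTheory.cgf X μ) l) atTop (𝓝 T) at hT
  have hmem : Ioi 0 ⊆ interior (ProbabilityTheory.integrableExpSet X μ) :=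
    fun t ht ↦ mem_interior_integrableExpSet_of_lamStar_eq_top hlam ht
  have hmono := monotoneOn_deriv_cgf (convex_Ioi 0) hmem
  refine ⟨T, le_antisymm (essSup_le_of_ae_le _ ?_) (le_sInf fun a ha ↦ ?_), hmono, hT⟩
  · have hle : ∀ t ∈ Ioi (0 : ℝ), deriv (ProbabilityTheory.cgf X μ) t ≤ T := by
      intro t ht
      refine ge_of_tendsto hT ?_
      filter_upwards [eventually_ge_atTop t] with s hs
      exact hmono ht (lt_of_lt_of_le ht hs) hs
    have hdiff : DifferentiableOn ℝ (ProbabilityTheory.cgf X μ) (Ioi 0) := fun t ht ↦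
      (ProbabilityTheory.analyticAt_cgf (hmem ht)).differentiableAt.differentiableWithinAt
    have hX : ∀ᵐ ω ∂μ, X ω ≤ T := by
      refine ae_le_of_cgf_le (b := ProbabilityTheory.cgf X μ 1 - T) ?_
      filter_upwards [eventually_ge_atTop 1] with t ht
      have ht0 : t ∈ Ioi (0 : ℝ) := zero_lt_one.trans_le ht
      refine ⟨interior_subset (s := ProbabilityTheory.integrableExpSet X μ) (hmem ht0), ?_⟩
      have hmv := (convex_Ioi (0 : ℝ)).image_sub_le_mul_sub_of_deriv_le hdiff.continuousOn
        (hdiff.mono interior_subset) (fun s hs ↦ hle s (interior_subset hs)) 1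
        (mem_Ioi.2 one_pos) t ht0 ht
      linarith
    filter_upwards [hX] with ω hω
    exact EReal.coe_le_coe_iff.2 hω
  · have hXa : ∀ᵐ ω ∂μ, (X ω : EReal) ≤ a := by simpa using ha
    induction a with
    | bot =>
      obtain ⟨ω, hω⟩ := hXa.exists
      exact absurd hω (by simp)
    | top => exact le_top
    | coe c =>
      refine EReal.coe_le_coe_iff.2 (le_of_tendsto hT ?_)
      filter_upwards [eventually_gt_atTop 0] with t ht
      exact deriv_cgf_le_of_ae_le (hmem ht) (hXa.mono fun ω hω ↦ EReal.coe_le_coe_iff.1 hω)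
end

section
/- Suppose E[X] = 0, P(X = 0) < 1, λ* = +∞, and Λ'(λ) converges to a finite limit as λ → +∞ (so ess sup X is finite). Then: I(x) ∈ (0, +∞) for every x ∈ (0, ess sup X); I(ess sup X) = −log P(X = ess sup X) (equal to +∞ if P(X = ess sup X) = 0); and I(x) = +∞ for every x > ess sup X. -/
open MeasureTheory Filter Set Topology

section RateFunction

variable {Ω : Type*} [MeasurableSpace Ω] {μ : Measure Ω} {X : Ω → ℝ}

theorem coe_sub_log_le_rateI {t : ℝ} (ht : Integrable (fun ω => Real.exp (t * X ω)) μ) (x : ℝ) :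
    ((t * x - Real.log (∫ ω, Real.exp (t * X ω) ∂μ) : ℝ) : EReal) ≤ rateI μ X x := by
  refine le_trans (le_of_eq ?_) (le_iSup _ t)
  rw [cgfE, if_pos ht, EReal.coe_sub]

theorem rateI_le_coe {x b : ℝ}
    (h : ∀ t : ℝ, Integrable (fun ω => Real.exp (t * X ω)) μ →
      t * x - Real.log (∫ ω, Real.exp (t * X ω) ∂μ) ≤ b) :
    rateI μ X x ≤ (b : EReal) := by
  refine iSup_le fun t => ?_
  by_cases ht : Integrable (fun ω => Real.exp (t * X ω)) μ
  · rw [cgfE, if_pos ht, ← EReal.coe_sub]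
    exact EReal.coe_le_coe_iff.2 (h t ht)
  · rw [cgfE, if_neg ht, EReal.sub_top]
    exact bot_le

theorem ae_le_of_essSup_coe_eq {c : ℝ} (h : essSup (fun ω => (X ω : EReal)) μ = (c : EReal)) :
    ∀ᵐ ω ∂μ, X ω ≤ c := by
  filter_upwards [ae_le_essSup (f := fun ω => (X ω : EReal)) (μ := μ)] with ω hω
  rw [h] at hω
  exact EReal.coe_le_coe_iff.1 hω

theorem measure_le_ne_zero_of_lt_essSup {c x : ℝ}
    (h : essSup (fun ω => (X ω : EReal)) μ = (c : EReal)) (hx : x < c) :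
    μ {ω | x ≤ X ω} ≠ 0 := by
  intro h0
  have hle : essSup (fun ω => (X ω : EReal)) μ ≤ (x : EReal) := by
    refine essSup_le_of_ae_le _ ?_
    have : ∀ᵐ ω ∂μ, ¬ x ≤ X ω := by
      rw [ae_iff]
      simpa using h0
    filter_upwards [this] with ω hω
    exact EReal.coe_le_coe_iff.2 (not_le.1 hω).le
  rw [h] at hle
  exact absurd (EReal.coe_le_coe_iff.1 hle) (not_le.2 hx)

theorem integrable_exp_mul_of_ae_le [IsFiniteMeasure μ] {c t : ℝ} (hX : Measurable X)
    (hc : ∀ᵐ ω ∂μ, X ω ≤ c) (ht : 0 ≤ t) : Integrable (fun ω => Real.exp (t * X ω)) μ := by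
  refine Integrable.of_bound (by fun_prop) (Real.exp (t * c)) ?_
  filter_upwards [hc] with ω hω
  rw [Real.norm_eq_abs, Real.abs_exp]
  gcongr

theorem one_le_integral_exp_mul [IsProbabilityMeasure μ] {t : ℝ} (hX : Integrable X μ)
    (hmean : ∫ ω, X ω ∂μ = 0) (ht : Integrable (fun ω => Real.exp (t * X ω)) μ) :
    1 ≤ ∫ ω, Real.exp (t * X ω) ∂μ := by
  have h : ∫ ω, (t * X ω + 1) ∂μ ≤ ∫ ω, Real.exp (t * X ω) ∂μ :=
    integral_mono ((hX.const_mul t).add (integrable_const 1)) ht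
      fun ω => Real.add_one_le_exp (t * X ω)
  rwa [integral_add (hX.const_mul t) (integrable_const 1), integral_const_mul, hmean,
    integral_const, probReal_univ, mul_zero, zero_add, one_smul] at h

theorem exp_mul_measureReal_le_integral_exp_mul [IsFiniteMeasure μ] {s : Set Ω} {t x : ℝ}
    (hs : MeasurableSet s) (hsx : ∀ ω ∈ s, t * x ≤ t * X ω)
    (ht : Integrable (fun ω => Real.exp (t * X ω)) μ) :
    Real.exp (t * x) * μ.real s ≤ ∫ ω, Real.exp (t * X ω) ∂μ := by
  calc Real.exp (t * x) * μ.real s = ∫ _ in s, Real.exp (t * x) ∂μ := by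
        rw [setIntegral_const, smul_eq_mul, mul_comm]
    _ ≤ ∫ ω in s, Real.exp (t * X ω) ∂μ :=
        setIntegral_mono_on (integrable_const _).integrableOn ht.integrableOn hs
          fun ω hω => Real.exp_le_exp.2 (hsx ω hω)
    _ ≤ ∫ ω, Real.exp (t * X ω) ∂μ :=
        setIntegral_le_integral ht (Eventually.of_forall fun ω => (Real.exp_pos _).le)

theorem mul_sub_log_integral_exp_le [IsFiniteMeasure μ] {s : Set Ω} {t x : ℝ}
    (hs : MeasurableSet s) (hs0 : μ s ≠ 0) (hsx : ∀ ω ∈ s, t * x ≤ t * X ω)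
    (ht : Integrable (fun ω => Real.exp (t * X ω)) μ) :
    t * x - Real.log (∫ ω, Real.exp (t * X ω) ∂μ) ≤ -Real.log (μ.real s) := by
  have hpos : 0 < μ.real s := ENNReal.toReal_pos hs0 (measure_ne_top μ s)
  have h := Real.log_le_log (by positivity) (exp_mul_measureReal_le_integral_exp_mul hs hsx ht)
  rw [Real.log_mul (Real.exp_pos _).ne' hpos.ne', Real.log_exp] at h
  linarith

/-- The moment generating function of a centred variable that is bounded above has vanishing
right derivative at the origin. -/
theorem tendsto_integral_exp_mul_sub_one_div [IsProbabilityMeasure μ] {c : ℝ}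
    (hmeas : Measurable X) (hX : Integrable X μ) (hmean : ∫ ω, X ω ∂μ = 0)
    (hc : ∀ᵐ ω ∂μ, X ω ≤ c) :
    Tendsto (fun t : ℝ => (∫ ω, Real.exp (t * X ω) ∂μ - 1) / t) (𝓝[>] 0) (𝓝 0) := by
  have hlim : Tendsto (fun t : ℝ => ∫ ω, (Real.exp (t * X ω) - 1) / t ∂μ) (𝓝[>] 0)
      (𝓝 (∫ ω, X ω ∂μ)) := by
    refine tendsto_integral_filter_of_dominated_convergence
      (fun ω => |X ω| * Real.exp |c|) ?_ ?_ (hX.abs.mul_const _) ?_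
    · exact Eventually.of_forall fun t => by fun_prop
    · filter_upwards [Ioo_mem_nhdsGT (zero_lt_one' ℝ)] with t ht
      filter_upwards [hc] with ω hω
      have ht0 : 0 < t := ht.1
      have h1 := Real.add_one_le_exp (t * X ω)
      have h2 := Real.add_one_le_exp (-(t * X ω))
      have hexp : Real.exp (t * X ω) - 1 ≤ t * X ω * Real.exp (t * X ω) := by
        have h3 : Real.exp (-(t * X ω)) * Real.exp (t * X ω) = 1 := by
          rw [← Real.exp_add]; simp
        nlinarith [Real.exp_pos (t * X ω)]
      have hE : Real.exp (t * X ω) ≤ Real.exp |c| := by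
        apply Real.exp_le_exp.2
        have := le_abs_self c
        have := abs_nonneg c
        nlinarith [ht.2]
      have hE1 : 1 ≤ Real.exp |c| := Real.one_le_exp (abs_nonneg c)
      rw [Real.norm_eq_abs, abs_div, abs_of_pos ht0, div_le_iff₀ ht0, abs_le]
      have hXa := abs_nonneg (X ω)
      have hlow := neg_abs_le (X ω)
      have hup := le_abs_self (X ω)
      constructor
      · have : |X ω| ≤ |X ω| * Real.exp |c| := le_mul_of_one_le_right hXa hE1
        nlinarith
      · calc Real.exp (t * X ω) - 1 ≤ t * X ω * Real.exp (t * X ω) := hexp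
          _ ≤ t * |X ω| * Real.exp |c| := by gcongr
          _ = |X ω| * Real.exp |c| * t := by ring
    · refine Eventually.of_forall fun ω => ?_
      have hd : HasDerivAt (fun t : ℝ => Real.exp (t * X ω)) (X ω) 0 := by
        simpa using ((hasDerivAt_id (0 : ℝ)).mul_const (X ω)).exp
      have := hd.tendsto_slope_zero_right
      refine this.congr fun t => ?_
      simp [div_eq_inv_mul]
  rw [hmean] at hlim
  refine hlim.congr' ?_
  filter_upwards [self_mem_nhdsWithin] with t ht
  have hi := integrable_exp_mul_of_ae_le hmeas hc (le_of_lt ht)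
  rw [integral_div, integral_sub hi (integrable_const 1), integral_const, probReal_univ, one_smul]

theorem rateI_pos [IsProbabilityMeasure μ] {c x : ℝ}
    (hmeas : Measurable X) (hX : Integrable X μ) (hmean : ∫ ω, X ω ∂μ = 0)
    (hc : ∀ᵐ ω ∂μ, X ω ≤ c) (hx : 0 < x) : 0 < rateI μ X x := by
  have hev := (tendsto_integral_exp_mul_sub_one_div hmeas hX hmean hc).eventually (gt_mem_nhds hx)
  obtain ⟨t, htx, ht⟩ := (hev.and self_mem_nhdsWithin).exists
  have ht0 : 0 < t := ht
  have hi := integrable_exp_mul_of_ae_le hmeas hc ht0.le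
  refine lt_of_lt_of_le ?_ (coe_sub_log_le_rateI hi x)
  rw [div_lt_iff₀ ht0] at htx
  have h1 := one_le_integral_exp_mul hX hmean hi
  have hlog := Real.log_le_sub_one_of_pos (zero_lt_one.trans_le h1)
  exact EReal.coe_pos.2 (by linarith)

theorem tendsto_integral_exp_mul_sub [IsFiniteMeasure μ] {c : ℝ} (hmeas : Measurable X)
    (hc : ∀ᵐ ω ∂μ, X ω ≤ c) :
    Tendsto (fun t : ℝ => ∫ ω, Real.exp (t * (X ω - c)) ∂μ) atTop
      (𝓝 (μ.real {ω | X ω = c})) := by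
  have hset : MeasurableSet {ω | X ω = c} := hmeas (measurableSet_singleton c)
  rw [← integral_indicator_one hset]
  refine tendsto_integral_filter_of_dominated_convergence (fun _ => 1) ?_ ?_
    (integrable_const 1) ?_
  · exact Eventually.of_forall fun t => by fun_prop
  · filter_upwards [eventually_ge_atTop 0] with t ht
    filter_upwards [hc] with ω hω
    rw [Real.norm_eq_abs, Real.abs_exp, Real.exp_le_one_iff]
    exact mul_nonpos_of_nonneg_of_nonpos ht (by linarith)
  · filter_upwards [hc] with ω hω
    by_cases h : X ω = c
    · simp [h]
    · have hneg : X ω - c < 0 := sub_neg.2 (lt_of_le_of_ne hω h)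
      simpa [h] using tendsto_id.atTop_mul_const_of_neg hneg

theorem neg_log_integral_exp_mul_sub_le_rateI [IsProbabilityMeasure μ] {t c : ℝ}
    (ht : Integrable (fun ω => Real.exp (t * X ω)) μ) :
    ((-Real.log (∫ ω, Real.exp (t * (X ω - c)) ∂μ) : ℝ) : EReal) ≤ rateI μ X c := by
  convert coe_sub_log_le_rateI ht c using 2
  have h : (fun ω => Real.exp (t * (X ω - c))) =
      fun ω => Real.exp (t * X ω) * Real.exp (-(t * c)) := by
    ext ω
    rw [← Real.exp_add]
    ring_nf
  rw [h, integral_mul_const, Real.log_mul (integral_exp_pos ht).ne' (Real.exp_pos _).ne',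
    Real.log_exp]
  ring

theorem rateI_eq_top_of_measure_eq_zero [IsProbabilityMeasure μ] {c : ℝ} (hmeas : Measurable X)
    (hc : ∀ᵐ ω ∂μ, X ω ≤ c) (h0 : μ {ω | X ω = c} = 0) : rateI μ X c = ⊤ := by
  have hlim := tendsto_integral_exp_mul_sub hmeas hc
  rw [measureReal_def, h0, ENNReal.toReal_zero] at hlim
  have hi : ∀ t : ℝ, 0 ≤ t → Integrable (fun ω => Real.exp (t * (X ω - c))) μ := fun t ht =>
    integrable_exp_mul_of_ae_le (X := fun ω => X ω - c) (c := 0) (by fun_prop)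
      (hc.mono fun ω hω => sub_nonpos.2 hω) ht
  have hlim' : Tendsto (fun t : ℝ => ∫ ω, Real.exp (t * (X ω - c)) ∂μ) atTop (𝓝[>] 0) := by
    refine tendsto_nhdsWithin_iff.2 ⟨hlim, ?_⟩
    filter_upwards [eventually_ge_atTop 0] with t ht
    exact integral_exp_pos (hi t ht)
  have htop := tendsto_neg_atBot_atTop.comp (Real.tendsto_log_nhdsGT_zero.comp hlim')
  refine EReal.eq_top_iff_forall_lt _ |>.2 fun b => ?_
  obtain ⟨t, hb, ht⟩ := ((htop.eventually_gt_atTop b).and (eventually_ge_atTop 0)).exists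
  exact (EReal.coe_lt_coe_iff.2 hb).trans_le
    (neg_log_integral_exp_mul_sub_le_rateI (integrable_exp_mul_of_ae_le hmeas hc ht))

theorem rateI_eq_neg_log_measure [IsProbabilityMeasure μ] {c : ℝ} (hmeas : Measurable X)
    (hc : ∀ᵐ ω ∂μ, X ω ≤ c) (h0 : μ {ω | X ω = c} ≠ 0) :
    rateI μ X c = ((-Real.log (μ.real {ω | X ω = c}) : ℝ) : EReal) := by
  refine le_antisymm (rateI_le_coe fun t ht => ?_) ?_
  · exact mul_sub_log_integral_exp_le (hmeas (measurableSet_singleton c)) h0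
      (fun ω (hω : X ω = c) => by rw [hω]) ht
  · have hpos : μ.real {ω | X ω = c} ≠ 0 := (ENNReal.toReal_pos h0 (measure_ne_top μ _)).ne'
    have hlim := (continuous_coe_real_ereal.tendsto _).comp
      ((tendsto_integral_exp_mul_sub hmeas hc).log hpos).neg
    refine le_of_tendsto hlim ?_
    filter_upwards [eventually_ge_atTop 0] with t ht
    exact neg_log_integral_exp_mul_sub_le_rateI (integrable_exp_mul_of_ae_le hmeas hc ht)

theorem rateI_eq_top_of_lt [IsProbabilityMeasure μ] {c x : ℝ} (hmeas : Measurable X)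
    (hc : ∀ᵐ ω ∂μ, X ω ≤ c) (hx : c < x) : rateI μ X x = ⊤ := by
  refine rateI_eq_top_of_measure_eq_zero hmeas (hc.mono fun ω hω => hω.trans hx.le) ?_
  have : ∀ᵐ ω ∂μ, ¬ X ω = x := hc.mono fun ω hω => (hω.trans_lt hx).ne
  simpa [ae_iff] using this

theorem rateI_lt_top [IsProbabilityMeasure μ] {x : ℝ}
    (hmeas : Measurable X) (hX : Integrable X μ) (hmean : ∫ ω, X ω ∂μ = 0) (hx : 0 ≤ x)
    (h0 : μ {ω | x ≤ X ω} ≠ 0) : rateI μ X x < ⊤ := by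
  refine lt_of_le_of_lt (rateI_le_coe (b := -Real.log (μ.real {ω | x ≤ X ω})) fun t ht => ?_)
    (EReal.coe_lt_top _)
  rcases le_total 0 t with h | h
  · exact mul_sub_log_integral_exp_le (measurableSet_le measurable_const hmeas) h0
      (fun ω hω => mul_le_mul_of_nonneg_left hω h) ht
  · have h1 := Real.log_nonneg (one_le_integral_exp_mul hX hmean ht)
    have h2 : Real.log (μ.real {ω | x ≤ X ω}) ≤ 0 :=
      Real.log_nonpos measureReal_nonneg measureReal_le_one
    have h3 := mul_nonpos_of_nonpos_of_nonneg h hx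
    linarith

end RateFunction

theorem stmt3 {Ω : Type*} [MeasurableSpace Ω] (μ : Measure Ω) [IsProbabilityMeasure μ]
    (X : Ω → ℝ) (hmeas : Measurable X) (hint : Integrable X μ)
    (hmean : ∫ ω, X ω ∂μ = 0) (hX0 : μ {ω | X ω = 0} < 1)
    (hlam : lamStar μ X = ⊤)
    (hconv : ∃ T : ℝ, Tendsto (fun l : ℝ => deriv (cgfR μ X) l) atTop (𝓝 T))
    (xmax : ℝ) (hxmax : essSup (fun ω => ((X ω : EReal))) μ = (xmax : EReal)) :
    (∀ x : ℝ, 0 < x → x < xmax → 0 < rateI μ X x ∧ rateI μ X x < ⊤) ∧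
    (μ {ω | X ω = xmax} = 0 → rateI μ X xmax = ⊤) ∧
    (μ {ω | X ω = xmax} ≠ 0 →
      rateI μ X xmax = ((-Real.log ((μ {ω | X ω = xmax}).toReal) : ℝ) : EReal)) ∧
    (∀ x : ℝ, xmax < x → rateI μ X x = ⊤) := by
  have hc := ae_le_of_essSup_coe_eq hxmax
  exact ⟨fun x hx hxm => ⟨rateI_pos hmeas hint hmean hc hx,
      rateI_lt_top hmeas hint hmean hx.le (measure_le_ne_zero_of_lt_essSup hxmax hxm)⟩,
    rateI_eq_top_of_measure_eq_zero hmeas hc, rateI_eq_neg_log_measure hmeas hc,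
    fun x hx => rateI_eq_top_of_lt hmeas hc hx⟩
end

section
/- Suppose E[X] = 0, P(X = 0) < 1, 0 < λ* < +∞, and Λ'(λ) converges to a finite limit T as λ ↑ λ*. Then E[exp(λ*·X)] < ∞, I(x) ∈ (0, +∞) for every x ∈ (0, T], and I(x) = λ*·x − Λ(λ*) for every x ≥ T. -/
open MeasureTheory Filter Set Topology

open ProbabilityTheory

section

variable {Ω : Type*} [MeasurableSpace Ω] {μ : Measure Ω} {X : Ω → ℝ}

/-- The graph of the cumulant generating function lies above its tangent at an interior point `s`
of its domain, in multiplicative form. -/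
lemma mgf_mul_exp_deriv_cgf_le [NeZero μ] {s t : ℝ}
    (hs : s ∈ interior (integrableExpSet X μ)) (ht : t ∈ integrableExpSet X μ) :
    mgf X μ s * Real.exp (deriv (cgf X μ) s * (t - s)) ≤ mgf X μ t := by
  have hs' : Integrable (fun ω => Real.exp (s * X ω)) μ :=
    interior_subset (s := integrableExpSet X μ) hs
  have hpos : 0 < mgf X μ s := mgf_pos' (NeZero.ne μ) hs'
  have hX : Integrable (fun ω => X ω * Real.exp (s * X ω)) μ := by
    simpa using integrable_pow_mul_exp_of_mem_interior_integrableExpSet hs 1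
  set m := deriv (cgf X μ) s with hm
  have hmean : ∫ ω, X ω * Real.exp (s * X ω) ∂μ = m * mgf X μ s := by
    rw [hm, deriv_cgf hs, div_mul_cancel₀ _ hpos.ne']
  have hpoint : ∀ ω, Real.exp (m * (t - s)) * ((1 - (t - s) * m) * Real.exp (s * X ω)
      + (t - s) * (X ω * Real.exp (s * X ω))) ≤ Real.exp (t * X ω) := fun ω => by
    have h := Real.add_one_le_exp ((t - s) * (X ω - m))
    have e : Real.exp (t * X ω) = Real.exp (m * (t - s)) * Real.exp (s * X ω)
        * Real.exp ((t - s) * (X ω - m)) := by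
      rw [← Real.exp_add, ← Real.exp_add]
      ring_nf
    rw [e]
    have := mul_le_mul_of_nonneg_left h
      (by positivity : 0 ≤ Real.exp (m * (t - s)) * Real.exp (s * X ω))
    linarith
  have hi := ((hs'.const_mul (1 - (t - s) * m)).add (hX.const_mul (t - s))).const_mul
    (Real.exp (m * (t - s)))
  have hle := integral_mono hi ht hpoint
  simp only [Pi.add_apply] at hle
  rw [integral_const_mul, integral_add (hs'.const_mul _) (hX.const_mul _), integral_const_mul,
    integral_const_mul, hmean] at hle
  change _ * (_ * mgf X μ s + _) ≤ mgf X μ t at hle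
  linarith

/-- If the derivative of the cumulant generating function converges to `T` at the right end `l` of
its domain, then the exponential moment at `l` is controlled by any other exponential moment. -/
lemma lintegral_exp_le_of_tendsto_deriv_cgf [NeZero μ] (hX : Measurable X) {a l T t : ℝ}
    (hal : a < l) (hint : Ioo a l ⊆ interior (integrableExpSet X μ))
    (hT : Tendsto (deriv (cgf X μ)) (𝓝[<] l) (𝓝 T)) (ht : t ∈ integrableExpSet X μ) :
    ∫⁻ ω, ENNReal.ofReal (Real.exp (l * X ω)) ∂μ
      ≤ ENNReal.ofReal (mgf X μ t * Real.exp (T * (l - t))) := by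
  have hid : Tendsto (fun s : ℝ => s) (𝓝[<] l) (𝓝 l) := tendsto_id.mono_left nhdsWithin_le_nhds
  have hlim : ∀ ω, liminf (fun s : ℝ => ENNReal.ofReal (Real.exp (s * X ω))) (𝓝[<] l)
      = ENNReal.ofReal (Real.exp (l * X ω)) := fun ω =>
    (ENNReal.tendsto_ofReal (Real.continuous_exp.tendsto _ |>.comp (hid.mul_const _))).liminf_eq
  have hbound : Tendsto (fun s => ENNReal.ofReal (mgf X μ t *
      Real.exp (deriv (cgf X μ) s * (s - t)))) (𝓝[<] l)
      (𝓝 (ENNReal.ofReal (mgf X μ t * Real.exp (T * (l - t))))) :=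
    ENNReal.tendsto_ofReal (((Real.continuous_exp.tendsto _).comp
      (hT.mul (hid.sub_const t))).const_mul _)
  calc ∫⁻ ω, ENNReal.ofReal (Real.exp (l * X ω)) ∂μ
      = ∫⁻ ω, liminf (fun s : ℝ => ENNReal.ofReal (Real.exp (s * X ω))) (𝓝[<] l) ∂μ := by
        simp_rw [hlim]
    _ ≤ liminf (fun s : ℝ => ∫⁻ ω, ENNReal.ofReal (Real.exp (s * X ω)) ∂μ) (𝓝[<] l) :=
        lintegral_liminf_le fun s => (Real.measurable_exp.comp (hX.const_mul s)).ennreal_ofReal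
    _ ≤ liminf (fun s => ENNReal.ofReal (mgf X μ t *
          Real.exp (deriv (cgf X μ) s * (s - t)))) (𝓝[<] l) := by
        refine liminf_le_liminf ?_
        filter_upwards [Ioo_mem_nhdsLT hal] with s hs
        have hs' : Integrable (fun ω => Real.exp (s * X ω)) μ :=
          interior_subset (s := integrableExpSet X μ) (hint hs)
        rw [← ofReal_integral_eq_lintegral_ofReal hs' (ae_of_all _ fun _ => (Real.exp_pos _).le)]
        refine ENNReal.ofReal_le_ofReal ?_
        have h := mul_le_mul_of_nonneg_right (mgf_mul_exp_deriv_cgf_le (hint hs) ht)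
          (Real.exp_pos (deriv (cgf X μ) s * (s - t))).le
        rwa [mul_assoc, ← Real.exp_add, ← mul_add, sub_add_sub_cancel, sub_self, mul_zero,
          Real.exp_zero, mul_one] at h
    _ = _ := hbound.liminf_eq

/-- The moment generating function has right derivative `μ[X]` at `0`. -/
lemma tendsto_mgf_sub_one_div [IsProbabilityMeasure μ] (hX : Integrable X μ) {l : ℝ}
    (hl : 0 < l) (hexp : Integrable (fun ω => Real.exp (l * X ω)) μ) :
    Tendsto (fun s => (mgf X μ s - 1) / s) (𝓝[>] 0) (𝓝 (∫ ω, X ω ∂μ)) := by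
  have hmem : Ioo 0 l ∈ 𝓝[>] (0 : ℝ) := Ioo_mem_nhdsGT hl
  have key : Tendsto (fun s : ℝ => ∫ ω, (Real.exp (s * X ω) - 1) / s ∂μ) (𝓝[>] 0)
      (𝓝 (∫ ω, X ω ∂μ)) := by
    refine tendsto_integral_filter_of_dominated_convergence
      (fun ω => |X ω| + (Real.exp (l * X ω) + 1) / l) ?_ ?_ ?_ ?_
    · refine Eventually.of_forall fun s => AEMeasurable.aestronglyMeasurable ?_
      exact ((Real.measurable_exp.comp_aemeasurable
        (hX.aemeasurable.const_mul s)).sub_const 1).div_const s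
    · filter_upwards [hmem] with s hs
      refine ae_of_all _ fun ω => ?_
      have hs0 : 0 < s := hs.1
      have h1 := Real.add_one_le_exp (s * X ω)
      have hconv := convexOn_exp.2 (mem_univ 0) (mem_univ (l * X ω))
        (sub_nonneg.2 ((div_le_one hl).2 hs.2.le)) (div_pos hs0 hl).le (sub_add_cancel 1 (s / l))
      simp only [smul_eq_mul, mul_zero, zero_add, Real.exp_zero, mul_one] at hconv
      rw [← mul_assoc, div_mul_cancel₀ _ hl.ne'] at hconv
      have hp : 0 ≤ (Real.exp (l * X ω) + 1) / l := by positivity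
      rw [Real.norm_eq_abs, abs_le]
      constructor
      · have : X ω ≤ (Real.exp (s * X ω) - 1) / s := by
          rw [le_div_iff₀ hs0]; linarith
        linarith [neg_abs_le (X ω)]
      · have : (Real.exp (s * X ω) - 1) / s ≤ (Real.exp (l * X ω) + 1) / l := by
          rw [div_le_iff₀ hs0]
          have e : (Real.exp (l * X ω) + 1) / l * s = s / l * Real.exp (l * X ω) + s / l := by ring
          have : 0 < s / l := div_pos hs0 hl
          linarith
        linarith [abs_nonneg (X ω)]
    · exact hX.abs.add ((hexp.add (integrable_const 1)).div_const l)
    · refine ae_of_all _ fun ω => ?_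
      have hd : HasDerivAt (fun s : ℝ => Real.exp (s * X ω)) (X ω) 0 := by
        simpa using ((hasDerivAt_id (0 : ℝ)).mul_const (X ω)).exp
      simpa [div_eq_inv_mul] using hd.tendsto_slope_zero_right
  refine key.congr' ?_
  filter_upwards [hmem] with s hs
  rw [integral_div, integral_sub
    (integrable_exp_mul_of_nonneg_of_le hexp hs.1.le hs.2.le) (integrable_const 1)]
  simp [mgf]

/-- A centred random variable has nonnegative cumulant generating function. -/
lemma cgf_nonneg_of_integral_eq_zero [IsProbabilityMeasure μ] (hX : Integrable X μ)
    (h0 : ∫ ω, X ω ∂μ = 0) {t : ℝ} (ht : t ∈ integrableExpSet X μ) : 0 ≤ cgf X μ t := by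
  refine Real.log_nonneg ?_
  have h := integral_mono ((hX.const_mul t).add (integrable_const 1)) ht
    fun ω => Real.add_one_le_exp (t * X ω)
  simp only [Pi.add_apply] at h
  rw [integral_add (hX.const_mul t) (integrable_const 1), integral_const_mul, h0] at h
  simpa [mgf] using h

lemma le_of_lamStar_eq {l t : ℝ} (hlam : lamStar μ X = (l : EReal)) (hl : 0 < l)
    (ht : t ∈ integrableExpSet X μ) : t ≤ l := by
  rcases le_total t 0 with h | h
  · exact h.trans hl.le
  · rw [← EReal.coe_le_coe_iff, ← hlam]
    exact le_sSup ⟨t, rfl, h, ht⟩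

lemma Ioo_subset_interior_of_lamStar_eq [IsProbabilityMeasure μ] {l : ℝ}
    (hlam : lamStar μ X = (l : EReal)) : Ioo 0 l ⊆ interior (integrableExpSet X μ) := by
  refine interior_maximal (fun s hs => ?_) isOpen_Ioo
  have hlt : (s : EReal) < lamStar μ X := by rw [hlam]; exact EReal.coe_lt_coe_iff.2 hs.2
  obtain ⟨_, ⟨r, rfl, -, hr⟩, hsr⟩ := lt_sSup_iff.1 hlt
  exact integrable_exp_mul_of_nonneg_of_le hr hs.1.le (EReal.coe_lt_coe_iff.1 hsr).le

lemma cgfE_of_mem {t : ℝ} (ht : t ∈ integrableExpSet X μ) : cgfE μ X t = (cgf X μ t : EReal) :=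
  if_pos ht

lemma coe_le_rateI {t : ℝ} (ht : t ∈ integrableExpSet X μ) (x : ℝ) :
    ((t * x - cgf X μ t : ℝ) : EReal) ≤ rateI μ X x := by
  refine le_trans (le_of_eq ?_) (le_iSup _ t)
  rw [cgfE_of_mem ht, EReal.coe_sub]

lemma rateI_le {x c : ℝ} (h : ∀ t ∈ integrableExpSet X μ, t * x - cgf X μ t ≤ c) :
    rateI μ X x ≤ (c : EReal) := by
  refine iSup_le fun t => ?_
  by_cases ht : t ∈ integrableExpSet X μ
  · rw [cgfE_of_mem ht, ← EReal.coe_sub]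
    exact EReal.coe_le_coe_iff.2 (h t ht)
  · rw [show cgfE μ X t = ⊤ from if_neg ht, EReal.sub_top]
    exact bot_le

end

theorem stmt4 {Ω : Type*} [MeasurableSpace Ω] (μ : Measure Ω) [IsProbabilityMeasure μ]
    (X : Ω → ℝ) (hmeas : Measurable X) (hint : Integrable X μ)
    (hmean : ∫ ω, X ω ∂μ = 0) (hX0 : μ {ω | X ω = 0} < 1)
    (lamS T : ℝ) (hlam : lamStar μ X = (lamS : EReal)) (hlampos : 0 < lamS)
    (hconv : Tendsto (fun l : ℝ => deriv (cgfR μ X) l) (𝓝[<] lamS) (𝓝 T)) :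
    Integrable (fun ω => Real.exp (lamS * X ω)) μ ∧
    (∀ x : ℝ, 0 < x → x ≤ T → 0 < rateI μ X x ∧ rateI μ X x < ⊤) ∧
    (∀ x : ℝ, T ≤ x → rateI μ X x = ((lamS * x - cgfR μ X lamS : ℝ) : EReal)) := by
  have hsub := Ioo_subset_interior_of_lamStar_eq hlam
  have hmoment : ∀ t ∈ integrableExpSet X μ, ∫⁻ ω, ENNReal.ofReal (Real.exp (lamS * X ω)) ∂μ
      ≤ ENNReal.ofReal (mgf X μ t * Real.exp (T * (lamS - t))) := fun t ht =>
    lintegral_exp_le_of_tendsto_deriv_cgf hmeas hlampos hsub hconv ht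
  have hzero : (0 : ℝ) ∈ integrableExpSet X μ := by simp [integrableExpSet]
  have hnonneg : ∀ᵐ ω ∂μ, 0 ≤ Real.exp (lamS * X ω) := ae_of_all _ fun _ => (Real.exp_pos _).le
  have hstar : Integrable (fun ω => Real.exp (lamS * X ω)) μ := by
    refine ⟨(Real.measurable_exp.comp (hmeas.const_mul lamS)).aestronglyMeasurable, ?_⟩
    rw [hasFiniteIntegral_iff_ofReal hnonneg]
    exact (hmoment 0 hzero).trans_lt ENNReal.ofReal_lt_top
  refine ⟨hstar, fun x hx _ => ⟨?_, ?_⟩, fun x hx => le_antisymm (rateI_le fun t ht => ?_) ?_⟩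
  · have hlim := tendsto_mgf_sub_one_div hint hlampos hstar
    rw [hmean] at hlim
    obtain ⟨s, hsx, hs⟩ :=
      ((hlim.eventually_lt_const hx).and (Ioo_mem_nhdsGT hlampos)).exists
    have hmem : s ∈ integrableExpSet X μ := interior_subset (hsub hs)
    have hlog : cgf X μ s ≤ mgf X μ s - 1 := Real.log_le_sub_one_of_pos (mgf_pos hmem)
    rw [div_lt_iff₀ hs.1] at hsx
    refine lt_of_lt_of_le (EReal.coe_lt_coe_iff.2 ?_) (coe_le_rateI hmem x)
    linarith
  · refine (rateI_le (c := lamS * x) fun t ht => ?_).trans_lt (EReal.coe_lt_top _)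
    have h1 := cgf_nonneg_of_integral_eq_zero hint hmean ht
    have h2 := mul_le_mul_of_nonneg_right (le_of_lamStar_eq hlam hlampos ht) hx.le
    linarith
  · have h := hmoment t ht
    have hpos : 0 < mgf X μ t := mgf_pos ht
    rw [← ofReal_integral_eq_lintegral_ofReal hstar hnonneg,
      ENNReal.ofReal_le_ofReal_iff (by positivity)] at h
    have hlog := Real.log_le_log (mgf_pos hstar) h
    rw [Real.log_mul hpos.ne' (Real.exp_pos _).ne', Real.log_exp] at hlog
    change cgfR μ X lamS ≤ cgf X μ t + _ at hlog
    have := mul_le_mul_of_nonneg_right hx (sub_nonneg.2 (le_of_lamStar_eq hlam hlampos ht))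
    linarith
  · exact coe_le_rateI hstar x
end

section
/- Let L > 0 be real and b an integer with 2 ≤ b ≤ m, and set a* := min{ (log m − I(x*))·(L + θx*)/(L + x*) + ((1−θ)x*/(L + x*))·log b , log m − I(θx*) }. If I(x*) = log m, then a* < log m − I(θx*). -/
open MeasureTheory Filter Set Topology

/-- `x* = sup {x ≥ 0 : I(x) ≤ log m}`. -/
noncomputable def xStar {Ω : Type*} [MeasurableSpace Ω] (μ : Measure Ω) (X : Ω → ℝ)
    (m : ℝ) : ℝ :=
  sSup {x : ℝ | 0 ≤ x ∧ rateI μ X x ≤ ((Real.log m : ℝ) : EReal)}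

/-- `a* = min{(log m − I(x*))·(L+θx*)/(L+x*) + ((1−θ)x*/(L+x*))·log b , log m − I(θx*)}`. -/
noncomputable def aStar {Ω : Type*} [MeasurableSpace Ω] (μ : Measure Ω) (X : Ω → ℝ)
    (m θ L : ℝ) (b : ℕ) : ℝ :=
  min ((Real.log m - (rateI μ X (xStar μ X m)).toReal) *
        (L + θ * xStar μ X m) / (L + xStar μ X m) +
        ((1 - θ) * xStar μ X m / (L + xStar μ X m)) * Real.log b)
      (Real.log m - (rateI μ X (θ * xStar μ X m)).toReal)

/-- The cumulant generating function of a centred variable is nonnegative. -/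
theorem cgfR_nonneg {Ω : Type*} [MeasurableSpace Ω] (μ : Measure Ω) [IsProbabilityMeasure μ]
    (X : Ω → ℝ) (hint : Integrable X μ) (hmean : ∫ ω, X ω ∂μ = 0) (t : ℝ)
    (ht : Integrable (fun ω => Real.exp (t * X ω)) μ) :
    0 ≤ Real.log (∫ ω, Real.exp (t * X ω) ∂μ) := by
  apply Real.log_nonneg
  calc (1 : ℝ) = ∫ ω, (t * X ω + 1) ∂μ := by
        rw [integral_add (hint.const_mul t) (integrable_const 1), integral_const_mul, hmean]
        simp
    _ ≤ ∫ ω, Real.exp (t * X ω) ∂μ :=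
        integral_mono ((hint.const_mul t).add (integrable_const 1)) ht
          fun ω => Real.add_one_le_exp (t * X ω)

theorem rateI_nonneg {Ω : Type*} [MeasurableSpace Ω] (μ : Measure Ω) [IsProbabilityMeasure μ]
    (X : Ω → ℝ) (x : ℝ) : 0 ≤ rateI μ X x := by
  refine le_trans ?_ (le_iSup _ (0 : ℝ))
  simp [cgfE]

/-- The rate function of a centred variable lies below its chords from the origin. -/
theorem rateI_mul_le {Ω : Type*} [MeasurableSpace Ω] (μ : Measure Ω) [IsProbabilityMeasure μ]
    (X : Ω → ℝ) (hint : Integrable X μ) (hmean : ∫ ω, X ω ∂μ = 0) {θ x c : ℝ}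
    (hθ0 : 0 ≤ θ) (hθ1 : θ ≤ 1) (hx : rateI μ X x ≤ (c : EReal)) :
    rateI μ X (θ * x) ≤ ((θ * c : ℝ) : EReal) := by
  refine iSup_le fun t => ?_
  have h := (le_iSup (fun t : ℝ => ((t * x : ℝ) : EReal) - cgfE μ X t) t).trans hx
  by_cases ht : Integrable (fun ω => Real.exp (t * X ω)) μ
  · have hΛ := cgfR_nonneg μ X hint hmean t ht
    simp only [cgfE, if_pos ht] at h ⊢
    norm_cast at h ⊢
    nlinarith [mul_le_mul_of_nonneg_left h hθ0, mul_nonneg (sub_nonneg.2 hθ1) hΛ]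
  · simp [cgfE, if_neg ht]

theorem stmt6 {Ω : Type*} [MeasurableSpace Ω] (μ : Measure Ω) [IsProbabilityMeasure μ]
    (X : Ω → ℝ) (hmeas : Measurable X) (hint : Integrable X μ)
    (hmean : ∫ ω, X ω ∂μ = 0) (hX0 : μ {ω | X ω = 0} < 1)
    (hmom : ∃ κ : ℝ, 0 < κ ∧ Integrable (fun ω => Real.exp (κ * X ω)) μ)
    (m θ L : ℝ) (b : ℕ) (hm : 1 < m) (hθ0 : 0 ≤ θ) (hθ1 : θ < 1)
    (hL : 0 < L) (hb : 2 ≤ b) (hbm : (b : ℝ) ≤ m)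
    (hxB : BddAbove {x : ℝ | 0 ≤ x ∧ rateI μ X x ≤ ((Real.log m : ℝ) : EReal)})
    (hxpos : 0 < xStar μ X m)
    (hIx : rateI μ X (xStar μ X m) = ((Real.log m : ℝ) : EReal)) :
    rateI μ X (θ * xStar μ X m) ≠ ⊤ ∧
    aStar μ X m θ L b < Real.log m - (rateI μ X (θ * xStar μ X m)).toReal := by
  have hle := rateI_mul_le μ X hint hmean hθ0 hθ1.le hIx.le
  have htop : rateI μ X (θ * xStar μ X m) ≠ ⊤ := ne_top_of_le_ne_top (EReal.coe_ne_top _) hle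
  refine ⟨htop, (min_le_left _ _).trans_lt ?_⟩
  have hbot : rateI μ X (θ * xStar μ X m) ≠ ⊥ :=
    ne_bot_of_le_ne_bot EReal.zero_ne_bot (rateI_nonneg μ X _)
  have hI : (rateI μ X (θ * xStar μ X m)).toReal ≤ θ * Real.log m := by
    simpa only [EReal.toReal_coe] using
      EReal.toReal_le_toReal hle hbot (EReal.coe_ne_top _)
  rw [hIx, EReal.toReal_coe, sub_self, zero_mul, zero_div, zero_add]
  have hb0 : (0 : ℝ) < b := by positivity
  have hlog : Real.log b ≤ Real.log m := Real.log_le_log hb0 hbm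
  have hlogm : 0 < Real.log m := Real.log_pos hm
  have hcoef : (1 - θ) * xStar μ X m / (L + xStar μ X m) < 1 - θ := by
    rw [div_lt_iff₀ (by positivity)]
    exact mul_lt_mul_of_pos_left (by linarith) (by linarith)
  have hcoef0 : 0 ≤ (1 - θ) * xStar μ X m / (L + xStar μ X m) :=
    div_nonneg (mul_nonneg (by linarith) hxpos.le) (by positivity)
  calc (1 - θ) * xStar μ X m / (L + xStar μ X m) * Real.log b
      ≤ (1 - θ) * xStar μ X m / (L + xStar μ X m) * Real.log m :=
        mul_le_mul_of_nonneg_left hlog hcoef0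
    _ < (1 - θ) * Real.log m := mul_lt_mul_of_pos_right hcoef hlogm
    _ ≤ Real.log m - (rateI μ X (θ * xStar μ X m)).toReal := by linarith
end

section
/- One has d(0) > 0, d(ρ̄) = 0, and the function ρ ↦ d(ρ) is decreasing on (0, ρ̄]. -/
open MeasureTheory Filter Set Topology

/-- `f(ρ) = log m − I(θx*/(1−ρ)) − a/(1−ρ)`, valued in `[-∞,∞)`. -/
noncomputable def fF {Ω : Type*} [MeasurableSpace Ω] (μ : Measure Ω) (X : Ω → ℝ)
    (m θ a ρ : ℝ) : EReal :=
  ((Real.log m : ℝ) : EReal) - rateI μ X (θ * xStar μ X m / (1 - ρ)) -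
    ((a / (1 - ρ) : ℝ) : EReal)

/-- `ρ̄ = sup {ρ ∈ (0,1) : f(ρ) ≥ 0}`. -/
noncomputable def rhoBar {Ω : Type*} [MeasurableSpace Ω] (μ : Measure Ω) (X : Ω → ℝ)
    (m θ a : ℝ) : ℝ :=
  sSup {ρ : ℝ | 0 < ρ ∧ ρ < 1 ∧ 0 ≤ fF μ X m θ a ρ}

/-- `g_ρ(h) = log m − I((h + θx*)/(1−ρ)) − a/(1−ρ)`, valued in `[-∞,∞)`.
(For `ρ = 0` this is the convention `g_0(h) = log m − I(h + θx*) − a`.) -/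
noncomputable def gG {Ω : Type*} [MeasurableSpace Ω] (μ : Measure Ω) (X : Ω → ℝ)
    (m θ a ρ h : ℝ) : EReal :=
  ((Real.log m : ℝ) : EReal) - rateI μ X ((h + θ * xStar μ X m) / (1 - ρ)) -
    ((a / (1 - ρ) : ℝ) : EReal)

/-- `d(ρ) = sup {h ≥ 0 : g_ρ(h) ≥ 0}`. -/
noncomputable def dD {Ω : Type*} [MeasurableSpace Ω] (μ : Measure Ω) (X : Ω → ℝ)
    (m θ a ρ : ℝ) : ℝ :=
  sSup {h : ℝ | 0 ≤ h ∧ 0 ≤ gG μ X m θ a ρ h}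

section RateFunction

variable {Ω : Type*} [MeasurableSpace Ω] {μ : Measure Ω} {X : Ω → ℝ}

lemma rateI_le_coe_iff {x A : ℝ} :
    rateI μ X x ≤ (A : EReal) ↔
      ∀ t : ℝ, Integrable (fun ω => Real.exp (t * X ω)) μ → t * x - cgfR μ X t ≤ A := by
  unfold rateI cgfE cgfR
  rw [iSup_le_iff]
  refine forall_congr' fun t => ?_
  by_cases h : Integrable (fun ω => Real.exp (t * X ω)) μ
  · simp only [h, if_true, true_imp_iff]
    rw [← EReal.coe_sub, EReal.coe_le_coe_iff]
  · simp [h]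

lemma rateI_zero_le [IsProbabilityMeasure μ] (hint : Integrable X μ)
    (hmean : ∫ ω, X ω ∂μ = 0) : rateI μ X 0 ≤ ((0 : ℝ) : EReal) := by
  rw [rateI_le_coe_iff]
  intro t ht
  have h1 : ∫ ω, (1 + t * X ω) ∂μ = 1 := by
    rw [integral_add (integrable_const _) (hint.const_mul t), integral_const_mul, hmean]
    simp
  have h2 : ∫ ω, (1 + t * X ω) ∂μ ≤ ∫ ω, Real.exp (t * X ω) ∂μ :=
    integral_mono ((integrable_const _).add (hint.const_mul t)) ht fun ω => by
      have := Real.add_one_le_exp (t * X ω)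
      simp only
      linarith
  have h3 : 0 ≤ cgfR μ X t := Real.log_nonneg (h1 ▸ h2)
  linarith

lemma rateI_convex_combination_le {x y A B s : ℝ} (hs0 : 0 ≤ s) (hs1 : s ≤ 1)
    (hx : rateI μ X x ≤ (A : EReal)) (hy : rateI μ X y ≤ (B : EReal)) :
    rateI μ X ((1 - s) * x + s * y) ≤ (((1 - s) * A + s * B : ℝ) : EReal) := by
  rw [rateI_le_coe_iff] at *
  intro t ht
  have h1 := mul_le_mul_of_nonneg_left (hx t ht) (sub_nonneg.2 hs1)
  have h2 := mul_le_mul_of_nonneg_left (hy t ht) hs0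
  linarith

lemma rateI_le_div_mul [IsProbabilityMeasure μ] (hint : Integrable X μ)
    (hmean : ∫ ω, X ω ∂μ = 0) {x y B : ℝ} (hx : 0 ≤ x) (hy : 0 < y) (hxy : x ≤ y)
    (hB : rateI μ X y ≤ (B : EReal)) : rateI μ X x ≤ ((x / y * B : ℝ) : EReal) := by
  have h := rateI_convex_combination_le (div_nonneg hx hy.le) ((div_le_one hy).2 hxy)
    (rateI_zero_le hint hmean) hB
  simpa only [mul_zero, zero_add, div_mul_cancel₀ x hy.ne'] using h

lemma pos_of_rateI_le [IsProbabilityMeasure μ] (hmean : ∫ ω, X ω ∂μ = 0)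
    (hmom : ∃ κ : ℝ, 0 < κ ∧ Integrable (fun ω => Real.exp (κ * X ω)) μ)
    (hmom' : ∃ κ' : ℝ, κ' < 0 ∧ Integrable (fun ω => Real.exp (κ' * X ω)) μ)
    {y B : ℝ} (hy : 0 < y) (hB : rateI μ X y ≤ (B : EReal)) : 0 < B := by
  obtain ⟨κ, hκ, hκi⟩ := hmom
  obtain ⟨κ', hκ', hκi'⟩ := hmom'
  have hIoo : ∀ t ∈ Ioo κ' κ, Integrable (fun ω => Real.exp (t * X ω)) μ := fun t ht =>
    ProbabilityTheory.integrable_exp_mul_of_le_of_le hκi' hκi ht.1.le ht.2.le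
  have hmem : (0 : ℝ) ∈ interior (ProbabilityTheory.integrableExpSet X μ) :=
    mem_interior.2 ⟨Ioo κ' κ, fun t ht => hIoo t ht, isOpen_Ioo, hκ', hκ⟩
  have hd := ProbabilityTheory.hasDerivAt_mgf hmem
  simp only [zero_mul, Real.exp_zero, mul_one, hmean] at hd
  have hslope := (hasDerivAt_iff_tendsto_slope.1 hd).eventually (gt_mem_nhds hy)
  have hslope' : ∀ᶠ t in 𝓝[>] (0 : ℝ), slope (ProbabilityTheory.mgf X μ) 0 t < y :=
    hslope.filter_mono (nhdsWithin_mono _ fun t ht => ne_of_gt ht)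
  obtain ⟨t, hst, ht⟩ := (hslope'.and (Ioo_mem_nhdsGT hκ)).exists
  have hti := hIoo t ⟨hκ'.trans ht.1, ht.2⟩
  rw [slope_def_field, ProbabilityTheory.mgf_zero, sub_zero, div_lt_iff₀ ht.1] at hst
  have hlog : cgfR μ X t ≤ ProbabilityTheory.mgf X μ t - 1 :=
    Real.log_le_sub_one_of_pos (ProbabilityTheory.mgf_pos hti)
  have := rateI_le_coe_iff.1 hB t hti
  linarith

end RateFunction

lemma EReal.zero_le_coe_sub_sub_coe_iff {L b : ℝ} {I : EReal} :
    0 ≤ (L : EReal) - I - (b : EReal) ↔ I ≤ ((L - b : ℝ) : EReal) := by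
  induction I using EReal.rec with
  | bot => simp
  | top => simp [-EReal.coe_sub]
  | coe r =>
    rw [← EReal.coe_sub, ← EReal.coe_sub, EReal.coe_le_coe_iff, EReal.coe_nonneg]
    constructor <;> intro h <;> linarith

lemma EReal.exists_coe_lt_of_coe_lt_coe_sub {L a : ℝ} {I : EReal}
    (h : (a : EReal) < (L : EReal) - I) : ∃ A : ℝ, I ≤ (A : EReal) ∧ A < L - a := by
  induction I using EReal.rec with
  | bot => exact ⟨L - a - 1, bot_le, by linarith⟩
  | top => simp at h
  | coe r =>
    rw [← EReal.coe_sub, EReal.coe_lt_coe_iff] at h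
    exact ⟨r, le_rfl, by linarith⟩

section Thresholds

variable {Ω : Type*} [MeasurableSpace Ω] {μ : Measure Ω} {X : Ω → ℝ} {m θ a : ℝ}

lemma fF_nonneg_iff {ρ : ℝ} : 0 ≤ fF μ X m θ a ρ ↔
    rateI μ X (θ * xStar μ X m / (1 - ρ)) ≤ ((Real.log m - a / (1 - ρ) : ℝ) : EReal) :=
  EReal.zero_le_coe_sub_sub_coe_iff

lemma gG_nonneg_iff {ρ h : ℝ} : 0 ≤ gG μ X m θ a ρ h ↔
    rateI μ X ((h + θ * xStar μ X m) / (1 - ρ)) ≤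
      ((Real.log m - a / (1 - ρ) : ℝ) : EReal) :=
  EReal.zero_le_coe_sub_sub_coe_iff

lemma dD_nonneg {ρ : ℝ} : 0 ≤ dD μ X m θ a ρ := Real.sSup_nonneg fun _ h => h.1

lemma rhoBar_nonneg : 0 ≤ rhoBar μ X m θ a := Real.sSup_nonneg fun _ h => h.1.le

lemma rhoBar_le_one : rhoBar μ X m θ a ≤ 1 := Real.sSup_le (fun _ h => h.2.1.le) zero_le_one

lemma le_rhoBar {ρ : ℝ} (h0 : 0 < ρ) (h1 : ρ < 1) (hf : 0 ≤ fF μ X m θ a ρ) :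
    ρ ≤ rhoBar μ X m θ a :=
  le_csSup ⟨1, fun _ h => h.2.1.le⟩ ⟨h0, h1, hf⟩

lemma xStar_nonneg : 0 ≤ xStar μ X m := Real.sSup_nonneg fun _ h => h.1

lemma bddAbove_setOf_gG_nonneg (hθ0 : 0 ≤ θ) (ha0 : 0 ≤ a)
    (hxB : BddAbove {x : ℝ | 0 ≤ x ∧ rateI μ X x ≤ ((Real.log m : ℝ) : EReal)})
    {ρ : ℝ} (hρ : ρ < 1) : BddAbove {h : ℝ | 0 ≤ h ∧ 0 ≤ gG μ X m θ a ρ h} := by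
  refine ⟨xStar μ X m * (1 - ρ), fun h hh => ?_⟩
  have hpos : 0 < 1 - ρ := sub_pos.2 hρ
  have hz : 0 ≤ θ * xStar μ X m := mul_nonneg hθ0 xStar_nonneg
  have hle : (h + θ * xStar μ X m) / (1 - ρ) ≤ xStar μ X m := by
    refine le_csSup hxB ⟨div_nonneg (add_nonneg hh.1 hz) hpos.le, ?_⟩
    refine (gG_nonneg_iff.1 hh.2).trans (EReal.coe_le_coe_iff.2 ?_)
    have := div_nonneg ha0 hpos.le
    linarith
  rw [div_le_iff₀ hpos] at hle
  linarith

/-- At `ρ = 1` division by zero makes the defining set of `dD` either empty or unbounded. -/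
lemma dD_one : dD μ X m θ a 1 = 0 := by
  unfold dD gG
  simp only [sub_self, div_zero]
  by_cases h : 0 ≤ ((Real.log m : ℝ) : EReal) - rateI μ X 0 - ((0 : ℝ) : EReal)
  · simp only [h, and_true]
    exact Real.sSup_of_not_bddAbove (not_bddAbove_Ici 0)
  · simp only [h, and_false, ofPred_false, Real.sSup_empty]

lemma dD_zero_pos (hθ0 : 0 ≤ θ) (hθ1 : θ < 1) (ha0 : 0 ≤ a)
    (ha : (a : EReal) < ((Real.log m : ℝ) : EReal) - rateI μ X (θ * xStar μ X m))
    (hxB : BddAbove {x : ℝ | 0 ≤ x ∧ rateI μ X x ≤ ((Real.log m : ℝ) : EReal)})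
    (hxpos : 0 < xStar μ X m) : 0 < dD μ X m θ a 0 := by
  obtain ⟨A, hA, hAlt⟩ := EReal.exists_coe_lt_of_coe_lt_coe_sub ha
  have hlt : θ * xStar μ X m < xStar μ X m := by nlinarith
  have hne : {x : ℝ | 0 ≤ x ∧ rateI μ X x ≤ ((Real.log m : ℝ) : EReal)}.Nonempty := by
    by_contra hne
    rw [xStar, not_nonempty_iff_eq_empty.1 hne, Real.sSup_empty] at hxpos
    exact lt_irrefl _ hxpos
  obtain ⟨y, ⟨-, hy⟩, hzy⟩ := exists_lt_of_lt_csSup hne hlt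
  have hcont : Tendsto (fun s : ℝ => (1 - s) * A + s * Real.log m) (𝓝[>] 0)
      (𝓝 ((1 - 0) * A + 0 * Real.log m)) :=
    (Continuous.tendsto (by fun_prop) 0).mono_left nhdsWithin_le_nhds
  have hev := hcont.eventually (gt_mem_nhds (show (1 - 0) * A + 0 * Real.log m <
    Real.log m - a by linarith))
  obtain ⟨s, hs, hs0, hs1⟩ := (hev.and (Ioo_mem_nhdsGT (zero_lt_one (α := ℝ)))).exists
  have hh : 0 < s * (y - θ * xStar μ X m) := mul_pos hs0 (sub_pos.2 hzy)
  refine hh.trans_le (le_csSup (bddAbove_setOf_gG_nonneg hθ0 ha0 hxB zero_lt_one)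
    ⟨hh.le, gG_nonneg_iff.2 ?_⟩)
  have hc := rateI_convex_combination_le hs0.le hs1.le hA hy
  rw [sub_zero, div_one, div_one, show s * (y - θ * xStar μ X m) + θ * xStar μ X m =
    (1 - s) * (θ * xStar μ X m) + s * y by ring]
  exact hc.trans (EReal.coe_le_coe_iff.2 hs.le)

lemma dD_rhoBar [IsProbabilityMeasure μ] (hint : Integrable X μ)
    (hmean : ∫ ω, X ω ∂μ = 0)
    (hmom : ∃ κ : ℝ, 0 < κ ∧ Integrable (fun ω => Real.exp (κ * X ω)) μ)
    (hmom' : ∃ κ' : ℝ, κ' < 0 ∧ Integrable (fun ω => Real.exp (κ' * X ω)) μ)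
    (hθ0 : 0 ≤ θ) : dD μ X m θ a (rhoBar μ X m θ a) = 0 := by
  rcases (rhoBar_le_one (μ := μ) (X := X) (m := m) (θ := θ) (a := a)).eq_or_lt with h1 | h1
  · rw [h1, dD_one]
  refine le_antisymm (Real.sSup_nonpos fun h hh => ?_) dD_nonneg
  by_contra! hpos
  have hg := gG_nonneg_iff.1 hh.2
  set r := rhoBar μ X m θ a with hr
  have hz : 0 ≤ θ * xStar μ X m := mul_nonneg hθ0 xStar_nonneg
  have hr1 : 0 < 1 - r := sub_pos.2 h1
  set y := (h + θ * xStar μ X m) / (1 - r) with hy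
  set B := Real.log m - a / (1 - r) with hB
  have hy0 : 0 < y := div_pos (by linarith) hr1
  have hB0 : 0 < B := pos_of_rateI_le hmean hmom hmom' hy0 hg
  have hzy : θ * xStar μ X m / (1 - r) < y := div_lt_div_of_pos_right (by linarith) hr1
  have hcz : ContinuousAt (fun ρ : ℝ => θ * xStar μ X m / (1 - ρ)) r :=
    continuousAt_const.div (by fun_prop) hr1.ne'
  have hca : ContinuousAt (fun ρ : ℝ => a / (1 - ρ)) r :=
    continuousAt_const.div (by fun_prop) hr1.ne'
  have hcF : ContinuousAt
      (fun ρ : ℝ => θ * xStar μ X m / (1 - ρ) / y * B + a / (1 - ρ)) r :=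
    ((hcz.div_const y).mul_const B).add hca
  have hF : θ * xStar μ X m / (1 - r) / y * B + a / (1 - r) < Real.log m := by
    have := mul_lt_of_lt_one_left hB0 ((div_lt_one hy0).2 hzy)
    linarith
  have hev : ∀ᶠ ρ in 𝓝[>] r, θ * xStar μ X m / (1 - ρ) < y ∧
      θ * xStar μ X m / (1 - ρ) / y * B + a / (1 - ρ) < Real.log m :=
    ((hcz.eventually (gt_mem_nhds hzy)).and (hcF.eventually (gt_mem_nhds hF))).filter_mono
      nhdsWithin_le_nhds
  obtain ⟨ρ, ⟨hρy, hρF⟩, hrρ, hρ1⟩ := (hev.and (Ioo_mem_nhdsGT h1)).exists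
  refine hrρ.not_ge (le_rhoBar (rhoBar_nonneg.trans_lt hrρ) hρ1 (fF_nonneg_iff.2 ?_))
  refine (rateI_le_div_mul hint hmean (div_nonneg hz (sub_pos.2 hρ1).le) hy0 hρy.le hg).trans
    (EReal.coe_le_coe_iff.2 ?_)
  linarith

lemma dD_le_dD [IsProbabilityMeasure μ] (hint : Integrable X μ)
    (hmean : ∫ ω, X ω ∂μ = 0)
    (hmom : ∃ κ : ℝ, 0 < κ ∧ Integrable (fun ω => Real.exp (κ * X ω)) μ)
    (hmom' : ∃ κ' : ℝ, κ' < 0 ∧ Integrable (fun ω => Real.exp (κ' * X ω)) μ)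
    (hθ0 : 0 ≤ θ) (ha0 : 0 ≤ a)
    (hxB : BddAbove {x : ℝ | 0 ≤ x ∧ rateI μ X x ≤ ((Real.log m : ℝ) : EReal)})
    {ρ₁ ρ₂ : ℝ} (h12 : ρ₁ ≤ ρ₂) (h2 : ρ₂ < 1) :
    dD μ X m θ a ρ₂ ≤ dD μ X m θ a ρ₁ := by
  have hp2 : 0 < 1 - ρ₂ := sub_pos.2 h2
  have hp1 : 0 < 1 - ρ₁ := by linarith
  have hz : 0 ≤ θ * xStar μ X m := mul_nonneg hθ0 xStar_nonneg
  refine Real.sSup_le (fun h hh => ?_) dD_nonneg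
  rcases hh.1.eq_or_lt with h0 | h0
  · exact h0 ▸ dD_nonneg
  refine le_csSup (bddAbove_setOf_gG_nonneg hθ0 ha0 hxB (h12.trans_lt h2))
    ⟨hh.1, gG_nonneg_iff.2 ?_⟩
  have hg := gG_nonneg_iff.1 hh.2
  have hnum : 0 < h + θ * xStar μ X m := by linarith
  have hy0 := div_pos hnum hp2
  have hxy : (h + θ * xStar μ X m) / (1 - ρ₁) ≤ (h + θ * xStar μ X m) / (1 - ρ₂) :=
    div_le_div_of_nonneg_left hnum.le hp2 (by linarith)
  have ha12 : a / (1 - ρ₁) ≤ a / (1 - ρ₂) := div_le_div_of_nonneg_left ha0 hp2 (by linarith)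
  refine (rateI_le_div_mul hint hmean (div_pos hnum hp1).le hy0 hxy hg).trans
    (EReal.coe_le_coe_iff.2 ?_)
  have := mul_le_of_le_one_left (pos_of_rateI_le hmean hmom hmom' hy0 hg).le
    ((div_le_one hy0).2 hxy)
  linarith

end Thresholds

theorem stmt9 {Ω : Type*} [MeasurableSpace Ω] (μ : Measure Ω) [IsProbabilityMeasure μ]
    (X : Ω → ℝ) (hmeas : Measurable X) (hint : Integrable X μ)
    (hmean : ∫ ω, X ω ∂μ = 0) (hX0 : μ {ω | X ω = 0} < 1)
    (hmom : ∃ κ : ℝ, 0 < κ ∧ Integrable (fun ω => Real.exp (κ * X ω)) μ)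
    (hmom' : ∃ κ' : ℝ, κ' < 0 ∧ Integrable (fun ω => Real.exp (κ' * X ω)) μ)
    (m θ a p₁ : ℝ) (hm : 1 < m) (hθ0 : 0 ≤ θ) (hθ1 : θ < 1)
    (hp₁ : 0 < p₁ ∧ p₁ < 1)
    (ha0 : 0 ≤ a) (ha : (a : EReal) < ((Real.log m : ℝ) : EReal) - rateI μ X (θ * xStar μ X m))
    (hxB : BddAbove {x : ℝ | 0 ≤ x ∧ rateI μ X x ≤ ((Real.log m : ℝ) : EReal)})
    (hxpos : 0 < xStar μ X m) :
    0 < dD μ X m θ a 0 ∧ dD μ X m θ a (rhoBar μ X m θ a) = 0 ∧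
    AntitoneOn (dD μ X m θ a) (Set.Ioc 0 (rhoBar μ X m θ a)) := by
  refine ⟨dD_zero_pos hθ0 hθ1 ha0 ha hxB hxpos, dD_rhoBar hint hmean hmom hmom' hθ0, ?_⟩
  intro ρ₁ _ ρ₂ hρ₂ h12
  rcases (hρ₂.2.trans rhoBar_le_one).eq_or_lt with h | h
  · rw [h, dD_one]
    exact dD_nonneg
  · exact dD_le_dD hint hmean hmom hmom' hθ0 ha0 hxB h12 h
end

section
/- Let (p_k)_{k ≥ 1} be a probability distribution on the positive integers with 0 < p₁ < 1 and finite mean ∑_{k ≥ 1} k·p_k < ∞, and define f : [0,1] → [0,1] by f(s) := ∑_{k ≥ 1} p_k·s^k. Then for every s ∈ (0,1), the limit lim_{n → ∞} f^{∘n}(s)/p₁ⁿ of the n-fold iterate of f at s divided by p₁ⁿ exists and is a finite, strictly positive real number. -/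
open Filter Topology

theorem linear_le_generatingFunction_le (p : ℕ → ℝ) (hp0 : p 0 = 0) (hnonneg : ∀ k, 0 ≤ p k)
    (hsum : HasSum p 1) {t : ℝ} (ht0 : 0 ≤ t) (ht1 : t ≤ 1) :
    p 1 * t ≤ ∑' k, p k * t ^ k ∧
      ∑' k, p k * t ^ k ≤ p 1 * t + (1 - p 1) * t ^ 2 := by
  have hsummable : Summable (fun k => p k * t ^ k) :=
    Summable.of_nonneg_of_le (fun k => mul_nonneg (hnonneg k) (pow_nonneg ht0 k))
      (fun k => mul_le_of_le_one_right (hnonneg k) (pow_le_one₀ ht0 ht1)) hsum.summable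
  constructor
  · simpa using hsummable.le_tsum 1 (fun k _ => mul_nonneg (hnonneg k) (pow_nonneg ht0 k))
  · have hmajorant := (hsum.mul_right (t ^ 2)).add (hasSum_ite_eq 1 (p 1 * (t - t ^ 2)))
    have hle := hasSum_le (fun k => ?_) hsummable.hasSum hmajorant
    · linarith
    · rcases k with _ | _ | k
      · simp [hp0]
      · simp
        linarith
      · have hpow : t ^ (k + 2) ≤ t ^ 2 := pow_le_pow_of_le_one ht0 ht1 (by omega)
        simpa using mul_le_mul_of_nonneg_left hpow (hnonneg (k + 2))

theorem exists_pos_tendsto_div_pow {a s : ℝ} (ha0 : 0 < a) (ha1 : a < 1) (hs0 : 0 < s)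
    (hs1 : s < 1) {x : ℕ → ℝ} (hx0 : x 0 = s)
    (hx : ∀ n, 0 ≤ x n → x n ≤ 1 →
      a * x n ≤ x (n + 1) ∧ x (n + 1) ≤ a * x n + (1 - a) * x n ^ 2) :
    ∃ C : ℝ, 0 < C ∧ Tendsto (fun n => x n / a ^ n) atTop (𝓝 C) := by
  set q := a + (1 - a) * s with hq
  have hq0 : 0 < q := by nlinarith
  have hq1 : q < 1 := by nlinarith
  have hgeom : ∀ n, 0 < x n ∧ x n ≤ s * q ^ n := by
    intro n
    induction n with
    | zero => simp [hx0, hs0]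
    | succ n ih =>
      obtain ⟨hpos, hle⟩ := ih
      have hxs : x n ≤ s := hle.trans (mul_le_of_le_one_right hs0.le (pow_le_one₀ hq0.le hq1.le))
      obtain ⟨hlow, hup⟩ := hx n hpos.le (hxs.trans hs1.le)
      refine ⟨(mul_pos ha0 hpos).trans_le hlow, ?_⟩
      calc x (n + 1) ≤ a * x n + (1 - a) * x n ^ 2 := hup
        _ = (a + (1 - a) * x n) * x n := by ring
        _ ≤ q * x n := by
          gcongr
          rw [hq]
          gcongr
        _ ≤ q * (s * q ^ n) := by gcongr
        _ = s * q ^ (n + 1) := by ring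
  have hle_one : ∀ n, x n ≤ 1 := fun n =>
    (hgeom n).2.trans ((mul_le_of_le_one_right hs0.le (pow_le_one₀ hq0.le hq1.le)).trans hs1.le)
  have hmono : Monotone (fun n => x n / a ^ n) := by
    refine monotone_nat_of_le_succ fun n => ?_
    rw [div_le_div_iff₀ (pow_pos ha0 n) (pow_pos ha0 _), pow_succ]
    have hlow := (hx n (hgeom n).1.le (hle_one n)).1
    nlinarith [mul_le_mul_of_nonneg_right hlow (pow_pos ha0 n).le]
  set c := (1 - a) / a * s with hc
  have hc0 : 0 ≤ c := mul_nonneg (div_nonneg (by linarith) ha0.le) hs0.le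
  have hexp : ∀ n, x n / a ^ n ≤ s * Real.exp (c * ∑ i ∈ Finset.range n, q ^ i) := by
    intro n
    induction n with
    | zero => simp [hx0]
    | succ n ih =>
      have hfactor : 1 + (1 - a) / a * x n ≤ Real.exp (c * q ^ n) := by
        have h := mul_le_mul_of_nonneg_left (hgeom n).2
          (div_nonneg (by linarith : 0 ≤ 1 - a) ha0.le)
        have h' := Real.add_one_le_exp (c * q ^ n)
        rw [hc] at h' ⊢
        linarith
      calc x (n + 1) / a ^ (n + 1) ≤ (a * x n + (1 - a) * x n ^ 2) / a ^ (n + 1) := by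
            gcongr
            exact (hx n (hgeom n).1.le (hle_one n)).2
        _ = x n / a ^ n * (1 + (1 - a) / a * x n) := by
            field_simp
            ring
        _ ≤ (s * Real.exp (c * ∑ i ∈ Finset.range n, q ^ i)) * Real.exp (c * q ^ n) :=
            mul_le_mul ih hfactor
              (add_nonneg zero_le_one
                (mul_nonneg (div_nonneg (by linarith) ha0.le) (hgeom n).1.le))
              (by positivity)
        _ = s * Real.exp (c * ∑ i ∈ Finset.range (n + 1), q ^ i) := by
            rw [Finset.sum_range_succ, mul_add, Real.exp_add, mul_assoc]
  have hbdd : BddAbove (Set.range fun n => x n / a ^ n) := by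
    refine ⟨s * Real.exp (c * ∑' i, q ^ i), ?_⟩
    rintro _ ⟨n, rfl⟩
    refine (hexp n).trans ?_
    gcongr
    exact (summable_geometric_of_lt_one hq0.le hq1).sum_le_tsum _
      (fun i _ => pow_nonneg hq0.le i)
  refine ⟨_, ?_, tendsto_atTop_ciSup hmono hbdd⟩
  refine hs0.trans_le ?_
  simpa [hx0] using le_ciSup hbdd 0

theorem stmt11 (p : ℕ → ℝ) (hp0 : p 0 = 0) (hnonneg : ∀ k, 0 ≤ p k)
    (hsum : ∑' k, p k = 1) (hp1pos : 0 < p 1) (hp1lt : p 1 < 1)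
    (hmean : Summable (fun k : ℕ => (k : ℝ) * p k))
    (f : ℝ → ℝ) (hf : ∀ s : ℝ, f s = ∑' k, p k * s ^ k) :
    ∀ s : ℝ, 0 < s → s < 1 →
      ∃ C : ℝ, 0 < C ∧ Tendsto (fun n : ℕ => f^[n] s / (p 1) ^ n) atTop (𝓝 C) := by
  intro s hs0 hs1
  have hp : HasSum p 1 := by
    have hsummable : Summable p := by
      by_contra h
      simp [tsum_eq_zero_of_not_summable h] at hsum
    exact hsum ▸ hsummable.hasSum
  refine exists_pos_tendsto_div_pow hp1pos hp1lt hs0 hs1 rfl fun n h0 h1 => ?_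
  rw [Function.iterate_succ_apply', hf]
  exact linear_le_generatingFunction_le p hp0 hnonneg hp h0 h1
end

section
/- Assume I is differentiable on (0, x*), a* < log m − I(θx*), and a ∈ (a*, log m − I(θx*)). Then the equation F_L(c) = 0 has a unique solution c̄(L) in the interval (0, (1−θ)x*/(L + x*)). -/
open MeasureTheory Filter Set Topology

/-- `F_L(c) = log m − I((θx* + Lc)/(1−c)) − (a − c log b)/(1−c)`, valued in `[-∞,∞)`. -/
noncomputable def fL {Ω : Type*} [MeasurableSpace Ω] (μ : Measure Ω) (X : Ω → ℝ)
    (m θ L : ℝ) (b : ℕ) (a c : ℝ) : EReal :=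
  ((Real.log m : ℝ) : EReal) - rateI μ X ((θ * xStar μ X m + L * c) / (1 - c)) -
    (((a - c * Real.log b) / (1 - c) : ℝ) : EReal)

/-- A pointwise supremum of affine functions on `[0, q]`, negative at `0` and positive at `q`,
has exactly one zero in `(0, q)`. -/
theorem existsUnique_zero_of_isLUB_affine {ι : Type*} {α β : ι → ℝ} {h : ℝ → ℝ} {q : ℝ}
    (hq : 0 < q) (hlub : ∀ c ∈ Icc 0 q, IsLUB (range fun i => α i + β i * c) (h c))
    (h0 : h 0 < 0) (hq' : 0 < h q) : ∃! c, c ∈ Ioo 0 q ∧ h c = 0 := by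
  have hconv : ConvexOn ℝ (Icc 0 q) h := by
    refine ⟨convex_Icc 0 q, fun x hx y hy u v hu hv huv => ?_⟩
    refine (hlub _ (convex_Icc 0 q hx hy hu hv huv)).2 ?_
    rintro _ ⟨i, rfl⟩
    have hxi : α i + β i * x ≤ h x := (hlub x hx).1 ⟨i, rfl⟩
    have hyi : α i + β i * y ≤ h y := (hlub y hy).1 ⟨i, rfl⟩
    have hαi : α i = u * α i + v * α i := by rw [← add_mul, huv, one_mul]
    simp only [smul_eq_mul]
    linarith [mul_le_mul_of_nonneg_left hxi hu, mul_le_mul_of_nonneg_left hyi hv]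
  have hcont : ContinuousOn h (Ioo 0 q) :=
    (hconv.subset Ioo_subset_Icc_self (convex_Ioo 0 q)).continuousOn isOpen_Ioo
  obtain ⟨r, hr, hrpos⟩ : ∃ r ∈ Ioo 0 q, 0 < h r := by
    obtain ⟨_, ⟨i, rfl⟩, hi⟩ := (lt_isLUB_iff (hlub q ⟨hq.le, le_rfl⟩)).1 hq'
    have hev : ∀ᶠ c in 𝓝[<] q, 0 < α i + β i * c :=
      ((by fun_prop : Continuous fun c => α i + β i * c).continuousAt.eventually
        (lt_mem_nhds hi)).filter_mono nhdsWithin_le_nhds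
    obtain ⟨r, hr, hr'⟩ := (hev.and (Ioo_mem_nhdsLT hq)).exists
    exact ⟨r, hr', hr.trans_le ((hlub r (Ioo_subset_Icc_self hr')).1 ⟨i, rfl⟩)⟩
  obtain ⟨s, hs, hsneg⟩ : ∃ s ∈ Ioo 0 r, h s < 0 := by
    have hev : ∀ᶠ ε in 𝓝[>] (0 : ℝ), (1 - ε) * h 0 + ε * h r < 0 :=
      ((by fun_prop : Continuous fun ε : ℝ => (1 - ε) * h 0 + ε * h r).continuousAt.eventually
        (gt_mem_nhds (by simpa using h0))).filter_mono nhdsWithin_le_nhds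
    obtain ⟨ε, hε, hε0, hε1⟩ := (hev.and (Ioo_mem_nhdsGT one_pos)).exists
    refine ⟨ε * r, ⟨mul_pos hε0 hr.1, by nlinarith [hr.1]⟩, lt_of_le_of_lt ?_ hε⟩
    simpa using hconv.2 ⟨le_rfl, hq.le⟩ (Ioo_subset_Icc_self hr) (sub_nonneg.2 hε1.le) hε0.le
      (by ring)
  obtain ⟨c, hc, hc0⟩ := intermediate_value_Icc hs.2.le
    (hcont.mono fun x hx => ⟨hs.1.trans_le hx.1, hx.2.trans_lt hr.2⟩) ⟨hsneg.le, hrpos.le⟩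
  have hne : ∀ x y : ℝ, 0 < x → x < y → y < q → h x = 0 → h y ≠ 0 := by
    intro x y hx hxy hyq hx0 hy0
    have hy : 0 < y := hx.trans hxy
    have key := hconv.2 ⟨le_rfl, hq.le⟩ ⟨hy.le, hyq.le⟩
      (sub_nonneg.2 ((div_le_one hy).2 hxy.le)) (div_pos hx hy).le (by ring)
    simp only [smul_eq_mul, mul_zero, zero_add, hy0, div_mul_cancel₀ x hy.ne', hx0, add_zero]
      at key
    exact absurd key (not_le.2 (mul_neg_of_pos_of_neg
      (sub_pos.2 ((div_lt_one hy).2 hxy)) h0))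
  refine ⟨c, ⟨⟨hs.1.trans_le hc.1, hc.2.trans_lt hr.2⟩, hc0⟩, ?_⟩
  rintro d ⟨hd, hd0⟩
  rcases lt_trichotomy d c with hlt | heq | hgt
  · exact absurd hc0 (hne d c hd.1 hlt (hc.2.trans_lt hr.2) hd0)
  · exact heq
  · exact absurd hd0 (hne c d (hs.1.trans_le hc.1) hgt hd.2 hc0)

/-- Where it is finite, the rate function is the real supremum of the affine functions
`x ↦ t x - Λ(t)` over the effective domain of the cumulant generating function. -/
theorem isLUB_toReal_rateI {Ω : Type*} [MeasurableSpace Ω] (μ : Measure Ω) [IsFiniteMeasure μ]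
    (X : Ω → ℝ) {x : ℝ} (hx : rateI μ X x ≠ ⊤) :
    IsLUB (range fun t : {t : ℝ // Integrable (fun ω => Real.exp (t * X ω)) μ} =>
      t * x - cgfR μ X t) (rateI μ X x).toReal := by
  have hterm : ∀ t : ℝ, Integrable (fun ω => Real.exp (t * X ω)) μ →
      ((t * x : ℝ) : EReal) - cgfE μ X t = ((t * x - cgfR μ X t : ℝ) : EReal) := by
    intro t ht
    rw [cgfE, if_pos ht, EReal.coe_sub]
    rfl
  have hle : ∀ t : ℝ, Integrable (fun ω => Real.exp (t * X ω)) μ →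
      ((t * x - cgfR μ X t : ℝ) : EReal) ≤ rateI μ X x := by
    intro t ht
    rw [← hterm t ht]
    exact le_iSup (fun t : ℝ => ((t * x : ℝ) : EReal) - cgfE μ X t) t
  have hbot : rateI μ X x ≠ ⊥ :=
    ne_bot_of_le_ne_bot (EReal.coe_ne_bot _) (hle 0 (by simp))
  constructor
  · rintro _ ⟨⟨t, ht⟩, rfl⟩
    rw [← EReal.coe_le_coe_iff, EReal.coe_toReal hx hbot]
    exact hle t ht
  · intro r hr
    rw [← EReal.coe_le_coe_iff, EReal.coe_toReal hx hbot]
    refine iSup_le fun t => ?_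
    by_cases ht : Integrable (fun ω => Real.exp (t * X ω)) μ
    · rw [hterm t ht]
      exact EReal.coe_le_coe_iff.2 (hr ⟨⟨t, ht⟩, rfl⟩)
    · rw [cgfE, if_neg ht, EReal.sub_top]
      exact bot_le

theorem rateI_ne_bot {Ω : Type*} [MeasurableSpace Ω] (μ : Measure Ω) [IsFiniteMeasure μ]
    (X : Ω → ℝ) (x : ℝ) : rateI μ X x ≠ ⊥ := by
  refine ne_bot_of_le_ne_bot ?_
    (le_iSup (fun t : ℝ => ((t * x : ℝ) : EReal) - cgfE μ X t) 0)
  rw [cgfE, if_pos (by simp), ← EReal.coe_sub]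
  exact EReal.coe_ne_bot _

theorem stmt16 {Ω : Type*} [MeasurableSpace Ω] (μ : Measure Ω) [IsProbabilityMeasure μ]
    (X : Ω → ℝ) (hmeas : Measurable X) (hint : Integrable X μ)
    (hmean : ∫ ω, X ω ∂μ = 0) (hX0 : μ {ω | X ω = 0} < 1)
    (hmom : ∃ κ : ℝ, 0 < κ ∧ Integrable (fun ω => Real.exp (κ * X ω)) μ)
    (m θ L : ℝ) (b : ℕ) (hm : 1 < m) (hθ0 : 0 ≤ θ) (hθ1 : θ < 1)
    (hL : 0 < L) (hb : 2 ≤ b) (hbm : (b : ℝ) ≤ m)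
    (hxB : BddAbove {x : ℝ | 0 ≤ x ∧ rateI μ X x ≤ ((Real.log m : ℝ) : EReal)})
    (hxpos : 0 < xStar μ X m)
    (hIfin : ∀ x : ℝ, 0 < x → x ≤ xStar μ X m → rateI μ X x ≠ ⊤)
    (hIθfin : rateI μ X (θ * xStar μ X m) ≠ ⊤)
    (hIdiff : DifferentiableOn ℝ (fun x : ℝ => (rateI μ X x).toReal)
      (Set.Ioo 0 (xStar μ X m)))
    (a : ℝ)
    (hstar : aStar μ X m θ L b < Real.log m - (rateI μ X (θ * xStar μ X m)).toReal)
    (haL : aStar μ X m θ L b < a)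
    (haU : a < Real.log m - (rateI μ X (θ * xStar μ X m)).toReal) :
    ∃! c : ℝ, c ∈ Set.Ioo 0 ((1 - θ) * xStar μ X m / (L + xStar μ X m)) ∧
      fL μ X m θ L b a c = 0 := by
  set x := xStar μ X m with hx
  set q := (1 - θ) * x / (L + x) with hqdef
  have hLx : 0 < L + x := by positivity
  have hq : 0 < q := div_pos (mul_pos (sub_pos.2 hθ1) hxpos) hLx
  have hqmul : q * (L + x) = (1 - θ) * x := div_mul_cancel₀ _ hLx.ne'
  have hq1 : q < 1 := by
    rw [hqdef, div_lt_one hLx]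
    nlinarith
  have h1q : 1 - q = (L + θ * x) / (L + x) := by
    rw [eq_div_iff hLx.ne']
    linear_combination -hqmul
  have hpos : ∀ c ∈ Icc 0 q, 0 < 1 - c := fun c hc => by linarith [hc.2]
  have hfin : ∀ c ∈ Icc 0 q, rateI μ X ((θ * x + L * c) / (1 - c)) ≠ ⊤ := by
    intro c hc
    rcases hc.1.eq_or_lt with rfl | hc0
    · simpa using hIθfin
    · refine hIfin _ (div_pos (by positivity) (hpos c hc)) ?_
      rw [div_le_iff₀ (hpos c hc)]
      nlinarith [mul_le_mul_of_nonneg_right hc.2 hLx.le]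
  let J : ℝ → ℝ := fun y => (rateI μ X y).toReal
  let h : ℝ → ℝ := fun c =>
    (1 - c) * J ((θ * x + L * c) / (1 - c)) + (a - c * Real.log b - (1 - c) * Real.log m)
  have hzero : ∀ c ∈ Ioo 0 q, (fL μ X m θ L b a c = 0 ↔ h c = 0) := by
    intro c hc
    have hc' := Ioo_subset_Icc_self hc
    have h1c := hpos c hc'
    have hJ : rateI μ X ((θ * x + L * c) / (1 - c)) = (J ((θ * x + L * c) / (1 - c)) : EReal) :=
      (EReal.coe_toReal (hfin c hc') (rateI_ne_bot μ X _)).symm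
    rw [fL, ← hx, hJ, ← EReal.coe_sub, ← EReal.coe_sub, EReal.coe_eq_zero]
    have hmul : h c = -(1 - c) * (Real.log m - J ((θ * x + L * c) / (1 - c)) -
        (a - c * Real.log b) / (1 - c)) := by
      simp only [h]
      field_simp
      ring
    rw [hmul, mul_eq_zero, or_iff_right (neg_ne_zero.2 h1c.ne')]
  have hlub : ∀ c ∈ Icc 0 q, IsLUB
      (range fun t : {t : ℝ // Integrable (fun ω => Real.exp (t * X ω)) μ} =>
        (t * (θ * x) - cgfR μ X t + a - Real.log m) +
          (t * L + cgfR μ X t - Real.log b + Real.log m) * c) (h c) := by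
    intro c hc
    have h1c := hpos c hc
    have hI := isLUB_toReal_rateI μ X (hfin c hc)
    have hterm : ∀ t : {t : ℝ // Integrable (fun ω => Real.exp (t * X ω)) μ},
        (t * (θ * x) - cgfR μ X t + a - Real.log m) +
          (t * L + cgfR μ X t - Real.log b + Real.log m) * c =
        (1 - c) * (t * ((θ * x + L * c) / (1 - c)) - cgfR μ X t) +
          (a - c * Real.log b - (1 - c) * Real.log m) := by
      intro t
      field_simp
      ring
    simp only [hterm]
    constructor
    · rintro _ ⟨t, rfl⟩
      exact add_le_add_left (mul_le_mul_of_nonneg_left (hI.1 ⟨t, rfl⟩) h1c.le) _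
    · intro r hr
      have hub : J ((θ * x + L * c) / (1 - c)) ≤
          (r - (a - c * Real.log b - (1 - c) * Real.log m)) / (1 - c) := by
        refine hI.2 ?_
        rintro _ ⟨t, rfl⟩
        rw [le_div_iff₀' h1c]
        exact le_sub_iff_add_le.2 (hr ⟨t, rfl⟩)
      rw [le_div_iff₀' h1c] at hub
      exact le_sub_iff_add_le.1 hub
  have h0 : h 0 < 0 := by
    simp only [h, J, mul_zero, add_zero, sub_zero, div_one, one_mul, zero_mul]
    linarith
  have hqpos : 0 < h q := by
    have hyq : (θ * x + L * q) / (1 - q) = x := by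
      rw [div_eq_iff (sub_pos.2 hq1).ne']
      linear_combination hqmul
    have hlt : (Real.log m - J x) * (L + θ * x) / (L + x) + q * Real.log b < a := by
      rcases min_lt_iff.1 haL with hlt | hlt
      · exact hlt
      · exact absurd hlt haU.not_gt
    rw [mul_div_assoc, ← h1q] at hlt
    simp only [h, hyq]
    linarith
  refine (existsUnique_congr fun c => and_congr_right fun hc => hzero c hc).2 ?_
  exact existsUnique_zero_of_isLUB_affine hq hlub h0 hqpos
end

section
/- Let b > 1 and α > 1 be reals, c > 0, and set β := b^{1/(α−1)} and a_k := (β − 1)·β^{−k}·c for integers k ≥ 1. Then for every integer t ≥ 1: (1) ∑_{k=1}^{t} a_k = (1 − β^{−t})·c, and (2) ∑_{k=1}^{t} a_k^α · b^k ≤ (β − 1)^{α−1} · c^α, i.e. ∑_{k=1}^{t} a_k^α · b^k ≤ (b^{1/(α−1)} − 1)^{α−1} · c^α. -/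
theorem sum_sub_one_mul_rpow_neg {β : ℝ} (hβ : 0 < β) (c : ℝ) (t : ℕ) :
    ∑ k ∈ Finset.Icc 1 t, (β - 1) * β ^ (-(k : ℝ)) * c = (1 - β ^ (-(t : ℝ))) * c := by
  induction t with
  | zero => simp
  | succ n ih =>
    have h : β ^ (-(n : ℝ)) = β * β ^ (-((n + 1 : ℕ) : ℝ)) := by
      rw [mul_comm, ← Real.rpow_add_one hβ.ne']
      push_cast
      ring_nf
    rw [Finset.sum_Icc_succ_top (by lia), ih, h]
    ring

theorem mul_rpow_neg_rpow_mul_rpow {β γ c : ℝ} (hβ : 0 < β) (hγ : 0 < γ) (hc : 0 < c)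
    (α x : ℝ) :
    (γ * β ^ (-x) * c) ^ α * (β ^ (α - 1)) ^ x =
      γ ^ (α - 1) * c ^ (α - 1) * (γ * β ^ (-x) * c) := by
  have ha : 0 < γ * β ^ (-x) * c := by positivity
  have hcancel : β ^ (-x * (α - 1)) * β ^ ((α - 1) * x) = 1 := by
    rw [← Real.rpow_add hβ, show -x * (α - 1) + (α - 1) * x = 0 by ring, Real.rpow_zero]
  calc
    (γ * β ^ (-x) * c) ^ α * (β ^ (α - 1)) ^ x
    _ = (γ * β ^ (-x) * c) ^ (α - 1) * (γ * β ^ (-x) * c) * (β ^ (α - 1)) ^ x := by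
      rw [← Real.rpow_add_one ha.ne', sub_add_cancel]
    _ = γ ^ (α - 1) * c ^ (α - 1) * (γ * β ^ (-x) * c) *
          (β ^ (-x * (α - 1)) * β ^ ((α - 1) * x)) := by
      rw [Real.mul_rpow (by positivity) hc.le, Real.mul_rpow hγ.le (by positivity),
        ← Real.rpow_mul hβ.le, ← Real.rpow_mul hβ.le]
      ring
    _ = γ ^ (α - 1) * c ^ (α - 1) * (γ * β ^ (-x) * c) := by rw [hcancel, mul_one]

theorem stmt18 (b α c : ℝ) (hb : 1 < b) (hα : 1 < α) (hc : 0 < c) :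
    ∀ t : ℕ, 1 ≤ t →
      (∑ k ∈ Finset.Icc 1 t,
          (b ^ (1 / (α - 1)) - 1) * (b ^ (1 / (α - 1))) ^ (-(k : ℝ)) * c) =
        (1 - (b ^ (1 / (α - 1))) ^ (-(t : ℝ))) * c ∧
      (∑ k ∈ Finset.Icc 1 t,
          ((b ^ (1 / (α - 1)) - 1) * (b ^ (1 / (α - 1))) ^ (-(k : ℝ)) * c) ^ α *
            b ^ (k : ℝ)) ≤
        (b ^ (1 / (α - 1)) - 1) ^ (α - 1) * c ^ α := by
  intro t _
  have hb0 : 0 < b := by linarith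
  have hα0 : 0 < α - 1 := by linarith
  have hβ : 1 < b ^ (1 / (α - 1)) := Real.one_lt_rpow hb (by positivity)
  have hbβ : (b ^ (1 / (α - 1))) ^ (α - 1) = b := by
    rw [← Real.rpow_mul hb0.le, one_div_mul_cancel hα0.ne', Real.rpow_one]
  generalize b ^ (1 / (α - 1)) = β at hβ hbβ ⊢
  subst hbβ
  have hβ0 : 0 < β := by linarith
  have hγ : 0 < β - 1 := by linarith
  refine ⟨sum_sub_one_mul_rpow_neg hβ0 c t, ?_⟩
  simp_rw [mul_rpow_neg_rpow_mul_rpow hβ0 hγ hc]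
  rw [← Finset.mul_sum, sum_sub_one_mul_rpow_neg hβ0]
  calc
    (β - 1) ^ (α - 1) * c ^ (α - 1) * ((1 - β ^ (-(t : ℝ))) * c)
    _ ≤ (β - 1) ^ (α - 1) * c ^ (α - 1) * (1 * c) := by
      gcongr
      linarith [Real.rpow_pos_of_pos hβ0 (-(t : ℝ))]
    _ = (β - 1) ^ (α - 1) * c ^ α := by
      rw [one_mul, mul_assoc, ← Real.rpow_add_one hc.ne', sub_add_cancel]
end
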